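/- Let d ≥ 1. Let ξ and η be equivariant random measures over the stationary ergodic flow system (Ω, 𝔉, ℙ, θ) with the same finite intensity, and assume that ℙ-a.s. both ξ and η do not charge small sets. Then there exists a factor allocation balancing ξ and η. -/

import Mathlib

open MeasureTheory Filter Set

noncomputable section

/-- Euclidean space `ℝ^d`. -/
abbrev Eucl (d : ℕ) := EuclideanSpace ℝ (Fin d)

/-- The half-open unit cube `[0,1)^d`. -/
def unitCube (d : ℕ) : Set (Eucl d) := {x | ∀ i, x i ∈ Set.Ico (0 : ℝ) 1}

/-- `μ` does not charge small sets: it gives no mass to `(d-1)`-rectifiable sets,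
i.e. `μ (f '' ℝ^(d-1)) = 0` for every Lipschitz map `f : ℝ^(d-1) → ℝ^d`. -/
def DoesNotChargeSmallSets (d : ℕ) (μ : Measure (Eucl d)) : Prop :=
  ∀ (f : Eucl (d - 1) → Eucl d) (K : NNReal), LipschitzWith K f → μ (Set.range f) = 0

variable {Ω : Type*} [MeasurableSpace Ω]

/-- The σ-algebra `σ(ξ, η)` generated by the measure-valued maps `ξ` and `η`. -/
def sigmaGen {d : ℕ} (ξ η : Ω → Measure (Eucl d)) : MeasurableSpace Ω :=
  MeasurableSpace.comap ξ inferInstance ⊔ MeasurableSpace.comap η inferInstance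

/-- `T` is a factor allocation for `(ξ, η)` over the flow `θ`: it is jointly measurable,
equivariant, and measurable with respect to `σ(ξ, η)` (times the Borel σ-algebra). -/
def IsFactorAllocation {d : ℕ} (θ : Eucl d → Ω → Ω) (ξ η : Ω → Measure (Eucl d))
    (T : Ω → Eucl d → Eucl d) : Prop :=
  Measurable (Function.uncurry T) ∧
  (∀ (ω : Ω) (x y : Eucl d), T (θ x ω) y = T ω (y + x) - x) ∧
  Measurable[(sigmaGen ξ η).prod (inferInstance : MeasurableSpace (Eucl d))]
    (Function.uncurry T)

section Aux

open ProbabilityTheory Topology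
open scoped ENNReal

/-- A lower bound for the distribution function of a finite measure to the right of `s` is a lower
bound at `s`. -/
lemma le_measure_Iic_of_forall_gt {μ : Measure EReal} [IsFiniteMeasure μ] {s : EReal} {c : ℝ≥0∞}
    (hc : c ≤ μ univ) (h : ∀ q, s < q → c ≤ μ (Iic q)) : c ≤ μ (Iic s) := by
  rcases eq_or_ne s ⊤ with rfl | hs
  · simpa using hc
  have hlim := tendsto_measure_biInter_gt (μ := μ) (s := fun q : EReal => Iic q) (a := s)
    (fun r _ => measurableSet_Iic.nullMeasurableSet) (fun i j _ hij => Iic_subset_Iic.2 hij)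
    ⟨⊤, hs.lt_top, measure_ne_top _ _⟩
  have hI : (⋂ r, ⋂ (_ : r > s), Iic r) = Iic s := by
    ext u
    simp only [mem_iInter, mem_Iic]
    exact ⟨fun hu => le_of_forall_gt_imp_ge_of_dense hu, fun hu r hr => hu.trans hr.le⟩
  rw [hI] at hlim
  have : (𝓝[>] s).NeBot := nhdsGT_neBot_of_exists_gt ⟨⊤, hs.lt_top⟩
  exact ge_of_tendsto hlim (eventually_mem_nhdsWithin.mono fun q hq => h q hq)

lemma measure_Iio_le_of_forall_lt {μ : Measure EReal} {s : EReal} {c : ℝ≥0∞}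
    (h : ∀ q, q < s → μ (Iic q) ≤ c) : μ (Iio s) ≤ c := by
  have hU : Iio s = ⋃ q ∈ {q : ℚ | ((q : ℝ) : EReal) < s}, Iic ((q : ℝ) : EReal) := by
    ext u
    simp only [mem_Iio, mem_iUnion, mem_Iic, exists_prop, mem_ofPred_eq]
    constructor
    · intro hu
      obtain ⟨q, h1, h2⟩ := EReal.lt_iff_exists_rat_btwn.1 hu
      exact ⟨q, h2, h1.le⟩
    · rintro ⟨q, h1, h2⟩
      exact h2.trans_lt h1
  rw [hU, measure_biUnion_eq_iSup (to_countable _)]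
  · exact iSup₂_le fun q hq => h _ hq
  · intro a ha b hb
    rcases le_total a b with hab | hab
    · exact ⟨b, hb, Iic_subset_Iic.2 (by exact_mod_cast hab), le_rfl⟩
    · exact ⟨a, ha, le_rfl, Iic_subset_Iic.2 (by exact_mod_cast hab)⟩

/-- The distribution function of a diffuse finite measure is uniformly distributed. -/
lemma measure_setOf_measure_Iic_le {μ : Measure EReal} [IsFiniteMeasure μ]
    [NullSingletonClass μ] {c : ℝ≥0∞}
    (hc : c ≤ μ univ) : μ {u | μ (Iic u) ≤ c} = c := by
  set S : Set EReal := {u | μ (Iic u) ≤ c} with hS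
  set s := sSup S with hs
  have hmono : ∀ {u v : EReal}, u ≤ v → μ (Iic u) ≤ μ (Iic v) :=
    fun h => measure_mono (Iic_subset_Iic.2 h)
  have hlow : ∀ q, q < s → μ (Iic q) ≤ c := by
    intro q hq
    obtain ⟨v, hv, hqv⟩ := lt_sSup_iff.1 hq
    exact (hmono hqv.le).trans hv
  have hμS : μ S = μ (Iic s) := by
    have hsub : S ⊆ Iic s := fun u hu => le_sSup hu
    apply le_antisymm (measure_mono hsub)
    rw [← measure_congr (Iio_ae_eq_Iic (μ := μ) (a := s))]
    exact measure_mono fun u hu => hlow u hu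
  rw [hμS]
  apply le_antisymm
  · rw [← measure_congr (Iio_ae_eq_Iic (μ := μ) (a := s))]
    exact measure_Iio_le_of_forall_lt hlow
  · apply le_measure_Iic_of_forall_gt hc
    intro q hq
    by_contra! hlt
    exact absurd (le_sSup (show q ∈ S from hlt.le)) (not_le.2 hq)

lemma measure_setOf_measure_Iic_lt {μ : Measure EReal} [IsFiniteMeasure μ]
    [NullSingletonClass μ] {c : ℝ≥0∞}
    (hc : c ≤ μ univ) : μ {u | μ (Iic u) < c} = c := by
  apply le_antisymm
  · exact (measure_mono fun u (hu : μ (Iic u) < c) => hu.le).trans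
      (measure_setOf_measure_Iic_le hc).le
  · refine le_of_forall_lt_imp_le_of_dense fun c' hc' => ?_
    rw [← measure_setOf_measure_Iic_le (hc'.le.trans hc)]
    exact measure_mono fun u (hu : μ (Iic u) ≤ c') => hu.trans_lt hc'

lemma measurable_kernel_section {X Z E : Type*} [MeasurableSpace X] [MeasurableSpace Z]
    [MeasurableSpace E] (κ : Kernel X E) [IsSFiniteKernel κ] {t : Set ((X × Z) × E)}
    (ht : MeasurableSet t) : Measurable fun p : X × Z => κ p.1 {e | (p, e) ∈ t} :=
  Kernel.measurable_kernel_prodMk_left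
    (κ := κ.comap (Prod.fst : X × Z → X) measurable_fst) ht

/-- The left-continuous quantile function of a measure on `EReal`. -/
def quantile (ν : Measure EReal) (t : ℝ≥0∞) : EReal :=
  ⨅ q : ℚ, if t ≤ ν (Iic ((q : ℝ) : EReal)) then ((q : ℝ) : EReal) else ⊤

lemma quantile_le_iff {ν : Measure EReal} [IsFiniteMeasure ν] {t : ℝ≥0∞} (ht : t ≤ ν univ)
    {s : EReal} : quantile ν t ≤ s ↔ t ≤ ν (Iic s) := by
  constructor
  · intro h
    apply le_measure_Iic_of_forall_gt ht
    intro r hr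
    obtain ⟨q, hq⟩ := iInf_lt_iff.1 (h.trans_lt hr)
    split_ifs at hq with hq'
    · exact hq'.trans (measure_mono (Iic_subset_Iic.2 hq.le))
    · exact absurd hq not_top_lt
  · intro h
    refine le_of_forall_gt_imp_ge_of_dense fun r hr => ?_
    obtain ⟨q, h1, h2⟩ := EReal.lt_iff_exists_rat_btwn.1 hr
    refine (iInf_le _ q).trans ?_
    rw [if_pos (h.trans (measure_mono (Iic_subset_Iic.2 h1.le)))]
    exact h2.le

lemma measurable_quantile {X : Type*} [MeasurableSpace X] (κ : Kernel X EReal) :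
    Measurable fun p : X × ℝ≥0∞ => quantile (κ p.1) p.2 := by
  refine Measurable.iInf fun q => Measurable.ite ?_ measurable_const measurable_const
  exact measurableSet_le measurable_snd
    ((κ.measurable_coe measurableSet_Iic).comp measurable_fst)

/-- Quantile matching: initial pieces of equal mass of two diffuse finite measures are mapped to
each other by composing a distribution function with a quantile function. -/
lemma map_quantile_restrict {μ ν : Measure EReal} [IsFiniteMeasure μ] [NullSingletonClass μ]
    [IsFiniteMeasure ν] [NullSingletonClass ν] {m : ℝ≥0∞} (hμ : m ≤ μ univ) (hν : m ≤ ν univ)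
    (hq : Measurable fun u => quantile ν (μ (Iic u))) :
    (μ.restrict {u | μ (Iic u) < m}).map (fun u => quantile ν (μ (Iic u))) =
      ν.restrict {u | ν (Iic u) < m} := by
  refine Measure.ext_of_Iic _ _ fun s => ?_
  rw [Measure.map_apply hq measurableSet_Iic, Measure.restrict_apply (hq measurableSet_Iic),
    Measure.restrict_apply measurableSet_Iic]
  have h1 : ((fun u => quantile ν (μ (Iic u))) ⁻¹' Iic s ∩ {u | μ (Iic u) < m}) =
      {u | μ (Iic u) ≤ ν (Iic s)} ∩ {u | μ (Iic u) < m} := by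
    ext u
    simp only [mem_inter_iff, mem_preimage, mem_Iic, mem_ofPred_eq]
    refine and_congr_left fun hu => quantile_le_iff (hu.le.trans hν)
  rw [h1]
  rcases lt_or_ge (ν (Iic s)) m with hs | hs
  · have h2 : {u | μ (Iic u) ≤ ν (Iic s)} ∩ {u | μ (Iic u) < m} = {u | μ (Iic u) ≤ ν (Iic s)} :=
      inter_eq_left.2 fun u hu => lt_of_le_of_lt hu hs
    have h3 : Iic s ∩ {u | ν (Iic u) < m} = Iic s :=
      inter_eq_left.2 fun u hu => (measure_mono (Iic_subset_Iic.2 hu)).trans_lt hs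
    rw [h2, h3, measure_setOf_measure_Iic_le (hs.le.trans hμ)]
  · have h2 : {u | μ (Iic u) ≤ ν (Iic s)} ∩ {u | μ (Iic u) < m} = {u | μ (Iic u) < m} :=
      inter_eq_right.2 fun u (hu : _ < m) => hu.le.trans hs
    have h3 : Iic s ∩ {u | ν (Iic u) < m} = {u | ν (Iic u) < m} :=
      inter_eq_right.2 fun u (hu : _ < m) => by
        by_contra hus
        exact absurd (hs.trans (measure_mono (Iic_subset_Iic.2 (not_le.1 hus).le))) (not_le.2 hu)
    rw [h2, h3, measure_setOf_measure_Iic_lt hμ, measure_setOf_measure_Iic_lt hν]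

/-- Two finite diffuse kernels can be matched measurably, until one of them is exhausted. -/
lemma exists_kernel_matching {X E : Type*} [MeasurableSpace X] [MeasurableSpace E]
    [StandardBorelSpace E] [Nonempty E] (μ ν : Kernel X E) [IsSFiniteKernel μ] [IsSFiniteKernel ν]
    (hμ : ∀ x, IsFiniteMeasure (μ x)) (hν : ∀ x, IsFiniteMeasure (ν x)) :
    ∃ (a b : Set (X × E)) (t : X × E → E), MeasurableSet a ∧ MeasurableSet b ∧ Measurable t ∧
      ∀ x, (∀ y, μ x {y} = 0) → (∀ y, ν x {y} = 0) →
        ((μ x).restrict {y | (x, y) ∈ a}).map (fun y => t (x, y)) =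
            (ν x).restrict {y | (x, y) ∈ b} ∧
          (μ x {y | (x, y) ∉ a} = 0 ∨ ν x {y | (x, y) ∉ b} = 0) := by
  set φ : E → EReal := fun y => (embeddingReal E y : EReal) with hφdef
  have hφ : MeasurableEmbedding φ :=
    EReal.measurableEmbedding_coe.comp (measurableEmbedding_embeddingReal E)
  obtain ⟨ψ, hψ, hψφ⟩ := hφ.exists_measurable_extend measurable_id fun _ => inferInstance
  have hψφ' : ∀ y, ψ (φ y) = y := fun y => congrFun hψφ y
  have hF : ∀ (κ : Kernel X E) [IsSFiniteKernel κ],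
      Measurable fun p : X × E => κ.map φ p.1 (Iic (φ p.2)) := by
    intro κ _
    exact measurable_kernel_section (κ.map φ)
      (t := {q : (X × E) × EReal | q.2 ≤ φ q.1.2})
      (measurableSet_le measurable_snd (hφ.measurable.comp (measurable_snd.comp measurable_fst)))
  have htot : ∀ (κ : Kernel X E) x, κ.map φ x univ = κ x univ := fun κ x => by
    rw [Kernel.map_apply' _ hφ.measurable _ MeasurableSet.univ, preimage_univ]
  set m : X → ℝ≥0∞ := fun x => min (μ x univ) (ν x univ) with hm
  have hmm : Measurable m :=
    (μ.measurable_coe MeasurableSet.univ).min (ν.measurable_coe MeasurableSet.univ)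
  have hmeas : ∀ (κ : Kernel X E) [IsSFiniteKernel κ],
      MeasurableSet {p : X × E | κ.map φ p.1 (Iic (φ p.2)) < m p.1} := fun κ _ =>
    measurableSet_lt (hF κ) (hmm.comp measurable_fst)
  refine ⟨{p | μ.map φ p.1 (Iic (φ p.2)) < m p.1}, {p | ν.map φ p.1 (Iic (φ p.2)) < m p.1},
    fun p => ψ (quantile (ν.map φ p.1) (μ.map φ p.1 (Iic (φ p.2)))), hmeas μ, hmeas ν,
    hψ.comp ((measurable_quantile (ν.map φ)).comp (measurable_fst.prodMk (hF μ))), ?_⟩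
  intro x hμx hνx
  have hfin : ∀ (κ : Kernel X E), IsFiniteMeasure (κ x) → IsFiniteMeasure (κ.map φ x) := by
    intro κ _
    rw [Kernel.map_apply _ hφ.measurable]
    infer_instance
  have hnull : ∀ (κ : Kernel X E), (∀ y, κ x {y} = 0) → NullSingletonClass (κ.map φ x) := by
    intro κ hκ
    constructor
    intro u
    rw [Kernel.map_apply' _ hφ.measurable _ (measurableSet_singleton u)]
    by_cases hu : ∃ y, φ y = u
    · obtain ⟨y, rfl⟩ := hu
      have : φ ⁻¹' {φ y} = {y} := by
        ext z
        simp [hφ.injective.eq_iff]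
      rw [this, hκ]
    · have : φ ⁻¹' {u} = ∅ := by
        ext z
        simpa using fun h => hu ⟨z, h⟩
      rw [this, measure_empty]
  have h1 := hfin μ (hμ x)
  have h2 := hfin ν (hν x)
  have h3 := hnull μ hμx
  have h4 := hnull ν hνx
  have hmμ : m x ≤ μ.map φ x univ := (min_le_left _ _).trans (htot μ x).ge
  have hmν : m x ≤ ν.map φ x univ := (min_le_right _ _).trans (htot ν x).ge
  have hIic : ∀ (κ : Kernel X E), Measurable fun u => κ.map φ x (Iic u) := fun κ =>
    Monotone.measurable fun u v huv => measure_mono (Iic_subset_Iic.2 huv)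
  have hq : Measurable fun u => quantile (ν.map φ x) (μ.map φ x (Iic u)) :=
    (measurable_quantile (ν.map φ)).comp (measurable_const.prodMk (hIic μ))
  have hA : ∀ (κ : Kernel X E), MeasurableSet {u | κ.map φ x (Iic u) < m x} := fun κ =>
    measurableSet_lt (hIic κ) measurable_const
  have key := map_quantile_restrict hmμ hmν hq
  have hres : ∀ (κ : Kernel X E), (κ.map φ x).restrict {u | κ.map φ x (Iic u) < m x} =
      ((κ x).restrict {y | κ.map φ x (Iic (φ y)) < m x}).map φ := by
    intro κ
    have := hA κ
    simp only [Kernel.map_apply _ hφ.measurable] at this ⊢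
    rw [Measure.restrict_map hφ.measurable this]
    rfl
  constructor
  · have := congrArg (Measure.map ψ) key
    rw [hres μ, hres ν, Measure.map_map hq hφ.measurable,
      Measure.map_map hψ (hq.comp hφ.measurable), Measure.map_map hψ hφ.measurable, hψφ,
      Measure.map_id] at this
    exact this
  · have hcompl : ∀ (κ : Kernel X E), IsFiniteMeasure (κ x) → NullSingletonClass (κ.map φ x) →
        m x = κ x univ → κ x {y | ¬ κ.map φ x (Iic (φ y)) < m x} = 0 := by
      intro κ _ hna hmx
      have hfk := hfin κ inferInstance
      have hAy : MeasurableSet {y | κ.map φ x (Iic (φ y)) < m x} :=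
        measurableSet_lt ((hIic κ).comp hφ.measurable) measurable_const
      have e := measure_setOf_measure_Iic_lt (μ := κ.map φ x) (c := m x) (by rw [htot, hmx])
      rw [Kernel.map_apply' _ hφ.measurable _ (hA κ)] at e
      have := measure_compl hAy (measure_ne_top (κ x) _)
      rw [show {y | κ.map φ x (Iic (φ y)) < m x} = φ ⁻¹' {u | κ.map φ x (Iic u) < m x} from rfl,
        e, hmx, tsub_self] at this
      rw [← hmx] at this
      exact this
    rcases min_choice (μ x univ) (ν x univ) with h | h
    · exact Or.inl (hcompl μ (hμ x) h3 h)
    · exact Or.inr (hcompl ν (hν x) h4 h)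

/-- A measurable, stationary and ergodic flow. -/
structure IsErgodicFlow {E Ω : Type*} [AddCommGroup E] [MeasurableSpace E] [MeasurableSpace Ω]
    (θ : E → Ω → Ω) (P : Measure Ω) : Prop where
  measurable : Measurable fun p : E × Ω => θ p.1 p.2
  zero : ∀ ω, θ 0 ω = ω
  add : ∀ x y ω, θ y (θ x ω) = θ (x + y) ω
  preserving : ∀ x, MeasurePreserving (θ x) P P
  ergodic : ∀ A : Set Ω, MeasurableSet A → (∀ x, θ x ⁻¹' A = A) → P A = 0 ∨ P A = 1

namespace IsErgodicFlow

section Basic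

variable {E Ω : Type*} [AddCommGroup E] [MeasurableSpace E] [MeasurableSpace Ω] {θ : E → Ω → Ω}
  {P : Measure Ω}

lemma neg_apply (hθ : IsErgodicFlow θ P) (x : E) (ω : Ω) : θ (-x) (θ x ω) = ω := by
  rw [hθ.add, add_neg_cancel, hθ.zero]

/-- Zero-one law for invariant properties. -/
lemma ae_or_ae_not [IsProbabilityMeasure P] (hθ : IsErgodicFlow θ P) {p : Ω → Prop}
    (hp : MeasurableSet {ω | p ω}) (hinv : ∀ x ω, p ω → p (θ x ω)) :
    (∀ᵐ ω ∂P, p ω) ∨ ∀ᵐ ω ∂P, ¬ p ω := by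
  have hiff : ∀ x ω, p (θ x ω) ↔ p ω := fun x ω =>
    ⟨fun h => by simpa only [hθ.neg_apply] using hinv (-x) _ h, hinv x ω⟩
  rcases hθ.ergodic _ hp (fun x => by ext ω; exact hiff x ω) with h | h
  · exact Or.inr (measure_eq_zero_iff_ae_notMem.1 h)
  · exact Or.inl ((prob_compl_eq_zero_iff hp).2 h)

lemma measurable_left (hθ : IsErgodicFlow θ P) (ω : Ω) : Measurable fun x => θ x ω :=
  hθ.measurable.comp (measurable_id.prodMk measurable_const)

lemma measurable_right (hθ : IsErgodicFlow θ P) (x : E) : Measurable (θ x) :=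
  hθ.measurable.comp (measurable_const.prodMk measurable_id)

/-- A set of positive probability is visited for a set of times of positive measure. -/
lemma ae_measure_visits_ne_zero [MeasurableAdd E] [IsProbabilityMeasure P]
    (hθ : IsErgodicFlow θ P) {m : Measure E} [SFinite m] [m.IsAddLeftInvariant] [NeZero m]
    {U : Set Ω} (hU : MeasurableSet U) (hPU : P U ≠ 0) :
    ∀ᵐ ω ∂P, m {x | θ x ω ∈ U} ≠ 0 := by
  have hmeas : Measurable fun ω => m {x | θ x ω ∈ U} :=
    measurable_measure_prodMk_left (ν := m) (s := {p : Ω × E | θ p.2 p.1 ∈ U})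
      ((hθ.measurable.comp measurable_swap) hU)
  have hinv : ∀ x ω, m {y | θ y (θ x ω) ∈ U} = m {y | θ y ω ∈ U} := by
    intro x ω
    rw [← measure_preimage_add m x {y | θ y ω ∈ U}]
    simp only [hθ.add]
    rfl
  refine (hθ.ae_or_ae_not (p := fun ω => m {x | θ x ω ∈ U} ≠ 0)
    (hmeas (measurableSet_singleton 0).compl) fun x ω h => by rwa [hinv]).resolve_right fun h => ?_
  have h0 : ∫⁻ ω, m {x | θ x ω ∈ U} ∂P = 0 := by
    rw [lintegral_eq_zero_iff hmeas]
    exact h.mono fun ω hω => not_not.1 hω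
  have hswap : ∫⁻ ω, m {x | θ x ω ∈ U} ∂P = ∫⁻ x, P (θ x ⁻¹' U) ∂m := by
    have hV : MeasurableSet {p : Ω × E | θ p.2 p.1 ∈ U} := (hθ.measurable.comp measurable_swap) hU
    exact (Measure.prod_apply hV).symm.trans (Measure.prod_apply_symm hV)
  rw [hswap] at h0
  simp only [fun x => (hθ.preserving x).measure_preimage hU.nullMeasurableSet, lintegral_const,
    mul_eq_zero, hPU, false_or, Measure.measure_univ_eq_zero] at h0
  exact NeZero.ne m h0

end Basic

section Section

variable {E Ω Y : Type*} [NormedAddCommGroup E] [NormedSpace ℝ E] [FiniteDimensional ℝ E]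
  [MeasurableSpace E] [BorelSpace E] [MeasurableSpace Ω] {θ : E → Ω → Ω} {P : Measure Ω}

/-- A locally free flow has a set of positive probability whose return times avoid an annulus. -/
lemma exists_clustered [IsProbabilityMeasure P] [MetricSpace Y] [SecondCountableTopology Y]
    [MeasurableSpace Y] [BorelSpace Y] (hθ : IsErgodicFlow θ P) {G : Ω → Y} (hG : Measurable G)
    (hGc : ∀ ω, Continuous fun v => G (θ v ω)) {r ε : ℝ} (hr : 0 < r)
    (hfree : ∀ᵐ ω ∂P, ∀ v, 0 < ‖v‖ → ‖v‖ ≤ ε → G (θ v ω) ≠ G ω) :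
    ∃ U : Set Ω, MeasurableSet U ∧ P U ≠ 0 ∧
      ∀ ω ∈ U, ∀ w, r ≤ ‖w‖ → ‖w‖ ≤ ε → θ w ω ∉ U := by
  set K : Set E := {w | r ≤ ‖w‖ ∧ ‖w‖ ≤ ε} with hK
  have hKc : IsCompact K := by
    refine (isCompact_closedBall (0 : E) ε).of_isClosed_subset ?_ fun w hw => by
      simpa using hw.2
    exact (isClosed_le continuous_const continuous_norm).inter
      (isClosed_le continuous_norm continuous_const)
  obtain ⟨D, hDK, hDc, hKD⟩ := hKc.isSeparable.exists_countable_dense_subset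
  obtain ⟨S, hSc, hSd⟩ := TopologicalSpace.exists_countable_dense Y
  set U : ℕ × S → Set Ω := fun q => {ω | (∀ w ∈ D, 1 / ((q.1 : ℝ) + 1) ≤ dist (G (θ w ω)) (G ω)) ∧
    dist (G ω) q.2 < 1 / ((q.1 : ℝ) + 1) / 2} with hU
  have hUm : ∀ q, MeasurableSet (U q) := by
    intro q
    have hUq : {ω | ∀ w ∈ D, 1 / ((q.1 : ℝ) + 1) ≤ dist (G (θ w ω)) (G ω)} =
        ⋂ w ∈ D, {ω | 1 / ((q.1 : ℝ) + 1) ≤ dist (G (θ w ω)) (G ω)} := by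
      ext; simp
    have hm : MeasurableSet {ω | ∀ w ∈ D, 1 / ((q.1 : ℝ) + 1) ≤ dist (G (θ w ω)) (G ω)} := by
      rw [hUq]
      exact MeasurableSet.biInter hDc fun w _ => measurableSet_le measurable_const
        ((hG.comp (hθ.measurable_right w)).dist hG)
    exact hm.inter (measurableSet_lt (hG.dist measurable_const) measurable_const)
  have hUK : ∀ q, ∀ ω ∈ U q, ∀ w, r ≤ ‖w‖ → ‖w‖ ≤ ε → θ w ω ∉ U q := by
    intro q ω hω w h1 h2 hw
    have hcl : IsClosed {w | 1 / ((q.1 : ℝ) + 1) ≤ dist (G (θ w ω)) (G ω)} :=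
      isClosed_le continuous_const ((hGc ω).dist continuous_const)
    have hle : 1 / ((q.1 : ℝ) + 1) ≤ dist (G (θ w ω)) (G ω) :=
      closure_minimal (fun w hw => hω.1 w hw) hcl (hKD ⟨h1, h2⟩)
    have := dist_triangle_right (G (θ w ω)) (G ω) q.2
    linarith [hω.2, hw.2]
  have hcov : ∀ᵐ ω ∂P, ∃ q, ω ∈ U q := by
    filter_upwards [hfree] with ω hω
    have hn : ∃ n : ℕ, ∀ w ∈ K, 1 / ((n : ℝ) + 1) ≤ dist (G (θ w ω)) (G ω) := by
      rcases K.eq_empty_or_nonempty with h | h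
      · exact ⟨0, by simp [h]⟩
      · obtain ⟨w0, hw0, hmin⟩ := hKc.exists_isMinOn h
          (f := fun w => dist (G (θ w ω)) (G ω)) ((hGc ω).dist continuous_const).continuousOn
        obtain ⟨n, hn⟩ := exists_nat_one_div_lt
          (dist_pos.2 (hω w0 (hr.trans_le hw0.1) hw0.2))
        exact ⟨n, fun w hw => hn.le.trans (hmin hw)⟩
    obtain ⟨n, hn⟩ := hn
    obtain ⟨s, hs, hs'⟩ := hSd.exists_dist_lt (G ω)
      (show (0 : ℝ) < 1 / ((n : ℝ) + 1) / 2 by positivity)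
    exact ⟨(n, ⟨s, hs⟩), fun w hw => hn w (hDK hw), hs'⟩
  by_contra! hcon
  have : Countable S := hSc
  have h0 : ∀ q, ∀ᵐ ω ∂P, ω ∉ U q := fun q => by
    rw [← measure_eq_zero_iff_ae_notMem]
    by_contra h
    obtain ⟨ω, hω, w, h1, h2, h3⟩ := hcon (U q) (hUm q) h
    exact hUK q ω hω w h1 h2 h3
  obtain ⟨ω, ⟨q, hq⟩, h⟩ := (hcov.and (ae_all_iff.2 h0)).exists
  exact h q hq

lemma setAverage_id_mem_closedBall {m : Measure E} {S : Set E} {c : E} {r : ℝ}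
    (h0 : m S ≠ 0) (h1 : m S ≠ ⊤) (hSr : S ⊆ Metric.closedBall c r) (hS : MeasurableSet S) :
    ⨍ y in S, y ∂m ∈ Metric.closedBall c r := by
  refine (convex_closedBall c r).set_average_mem Metric.isClosed_closedBall h0 h1
    (by filter_upwards [ae_restrict_mem hS] with y hy using hSr hy) ?_
  refine Measure.integrableOn_of_bounded (M := ‖c‖ + r) h1 measurable_id.aestronglyMeasurable ?_
  filter_upwards [ae_restrict_mem hS] with y hy
  have := hSr hy
  rw [mem_closedBall_iff_norm] at this
  calc ‖id y‖ = ‖c + (y - c)‖ := by simp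
    _ ≤ _ := (norm_add_le _ _).trans (by gcongr)

lemma setAverage_id_translate {m : Measure E} [m.IsAddHaarMeasure] {S : Set E} {R : ℝ} {c : E}
    (z : E) (h0 : m S ≠ 0) (hSr : S ⊆ Metric.ball c R) (hS : MeasurableSet S) :
    ⨍ y in {y | y + z ∈ S}, y ∂m = (⨍ y in S, y ∂m) - z := by
  have h1 : m S ≠ ⊤ := ((measure_mono hSr).trans_lt measure_ball_lt_top).ne
  have hmS : m {y | y + z ∈ S} = m S := measure_preimage_add_right m z S
  have hint : IntegrableOn (fun y => y) S m := by
    refine Measure.integrableOn_of_bounded (M := ‖c‖ + R) h1 measurable_id.aestronglyMeasurable ?_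
    filter_upwards [ae_restrict_mem hS] with y hy
    have := hSr hy
    rw [mem_ball_iff_norm] at this
    calc ‖id y‖ = ‖c + (y - c)‖ := by simp
      _ ≤ _ := (norm_add_le _ _).trans (by gcongr)
  have hI : ∫ y in {y | y + z ∈ S}, y ∂m = ∫ y in S, (y - z) ∂m := by
    have h := (measurePreserving_add_right m z).setIntegral_preimage_emb
      (measurableEmbedding_addRight z) (fun y => y - z) S
    simp only [add_sub_cancel_right] at h
    exact h
  rw [setAverage_eq, setAverage_eq, hI, integral_sub hint (integrableOn_const h1), measureReal_def,
    hmS, ← measureReal_def, smul_sub, setIntegral_const, smul_smul, inv_mul_cancel₀, one_smul]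
  exact ENNReal.toReal_ne_zero.2 ⟨h0, h1⟩

/-- A locally free flow has a measurable uniformly separated section, together with a measurable
map locating the nearby point of the section. -/
theorem exists_section [IsProbabilityMeasure P] [MetricSpace Y] [SecondCountableTopology Y]
    [MeasurableSpace Y] [BorelSpace Y] (hθ : IsErgodicFlow θ P) {G : Ω → Y} (hG : Measurable G)
    (hGc : ∀ ω, Continuous fun v => G (θ v ω)) {ε : ℝ} (hε : 0 < ε)
    (hfree : ∀ᵐ ω ∂P, ∀ v, 0 < ‖v‖ → ‖v‖ ≤ ε → G (θ v ω) ≠ G ω) :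
    ∃ ρ > 0, ∃ (U : Set Ω) (l : Ω → E), MeasurableSet U ∧ Measurable l ∧
      (∀ ω z, ‖z‖ < ρ → θ z ω ∈ U → z = l ω) ∧ ∀ᵐ ω ∂P, ∃ z, θ z ω ∈ U := by
  set m : Measure E := Measure.addHaar with hm
  set r : ℝ := ε / 6 with hr
  have hr0 : 0 < r := by positivity
  have hεr : ε = 6 * r := by rw [hr]; ring
  obtain ⟨A, hA, hPA, hsep⟩ := hθ.exists_clustered hG hGc hr0 hfree
  set C : Ω → Set E := fun ω => {x | θ x ω ∈ A} with hC
  have hCm : ∀ ω, MeasurableSet (C ω) := fun ω => hθ.measurable_left ω hA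
  have hclose : ∀ ω, ∀ x ∈ C ω, ∀ y ∈ C ω, ‖y - x‖ ≤ 6 * r → ‖y - x‖ < r := by
    intro ω x hx y hy hxy
    by_contra! h
    refine hsep _ hx (y - x) h (hxy.trans hεr.ge) ?_
    rw [hθ.add, add_sub_cancel]
    exact hy
  set N : Ω → E → Set E := fun ω z => C ω ∩ Metric.ball z (3 * r) with hN
  have hNm : ∀ ω z, MeasurableSet (N ω z) := fun ω z => (hCm ω).inter measurableSet_ball
  have hNfin : ∀ ω z, m (N ω z) ≠ ⊤ := fun ω z =>
    ((measure_mono inter_subset_right).trans_lt measure_ball_lt_top).ne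
  have hNsub : ∀ ω z, ∀ c ∈ N ω z, N ω z ⊆ Metric.closedBall c r := by
    intro ω z c hc y hy
    rw [mem_closedBall_iff_norm]
    refine (hclose ω c hc.1 y hy.1 ?_).le
    have h1 := mem_ball_iff_norm.1 hc.2
    have h2 := mem_ball_iff_norm.1 hy.2
    calc ‖y - c‖ = ‖(y - z) - (c - z)‖ := by congr 1; abel
      _ ≤ ‖y - z‖ + ‖c - z‖ := norm_sub_le _ _
      _ ≤ 6 * r := by linarith
  set b : Ω → E → E := fun ω z => ⨍ y in N ω z, y ∂m with hb
  have hbc : ∀ ω z, m (N ω z) ≠ 0 → ∀ c ∈ N ω z, ‖b ω z - c‖ ≤ r := fun ω z h c hc =>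
    mem_closedBall_iff_norm.1
      (setAverage_id_mem_closedBall h (hNfin ω z) (hNsub ω z c hc) (hNm ω z))
  have hNshift : ∀ ω z, N (θ z ω) 0 = {y | y + z ∈ N ω z} := by
    intro ω z
    ext y
    simp only [hN, hC, mem_inter_iff, mem_ofPred_eq, mem_ball_iff_norm, hθ.add, sub_zero,
      add_sub_cancel_right, add_comm z y]
  have hmshift : ∀ ω z, m (N (θ z ω) 0) = m (N ω z) := fun ω z => by
    rw [hNshift]
    exact measure_preimage_add_right m z (N ω z)
  have hbshift : ∀ ω z, m (N ω z) ≠ 0 → b (θ z ω) 0 = b ω z - z := fun ω z h => by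
    simp only [hb, hNshift]
    exact setAverage_id_translate z h inter_subset_right (hNm ω z)
  have hmeasN : MeasurableSet {p : Ω × E | p.2 ∈ N p.1 0} := by
    have h1 : MeasurableSet {p : Ω × E | θ p.2 p.1 ∈ A} := (hθ.measurable.comp measurable_swap) hA
    have h2 : MeasurableSet {p : Ω × E | p.2 ∈ Metric.ball (0 : E) (3 * r)} :=
      measurable_snd measurableSet_ball
    exact h1.inter h2
  have hLm : Measurable fun ω => m (N ω 0) := by
    have h := measurable_measure_prodMk_left (ν := m) hmeasN
    exact h
  have hbm : Measurable fun ω => b ω 0 := by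
    simp only [hb, setAverage_eq, measureReal_def]
    refine hLm.ennreal_toReal.inv.smul ?_
    simp only [← integral_indicator (hNm _ 0)]
    refine StronglyMeasurable.measurable
      (StronglyMeasurable.integral_prod_right (f := fun ω y => (N ω 0).indicator (fun y => y) y) ?_)
    exact (Measurable.indicator measurable_snd hmeasN).stronglyMeasurable
  refine ⟨r, hr0, {ω | m (N ω 0) ≠ 0 ∧ b ω 0 = 0}, fun ω => b ω 0,
    (hLm (measurableSet_singleton 0).compl).inter (hbm (measurableSet_singleton 0)), hbm, ?_, ?_⟩
  · rintro ω z hz ⟨h1, h2⟩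
    rw [hmshift] at h1
    rw [hbshift _ _ h1, sub_eq_zero] at h2
    obtain ⟨c, hc⟩ := nonempty_of_measure_ne_zero h1
    have hcz : ‖z - c‖ ≤ r := by simpa [h2] using hbc ω z h1 c hc
    have hc0 : ‖c‖ < 2 * r := by
      calc ‖c‖ = ‖z - (z - c)‖ := by simp
        _ ≤ ‖z‖ + ‖z - c‖ := norm_sub_le _ _
        _ < 2 * r := by linarith
    have hNN : N ω 0 = N ω z := by
      ext y
      constructor
      · intro hy
        have hy0 : ‖y‖ < 3 * r := by simpa using hy.2
        have hyc : ‖y - c‖ < r := hclose ω c hc.1 y hy.1 ((norm_sub_le _ _).trans (by linarith))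
        refine ⟨hy.1, mem_ball_iff_norm.2 ?_⟩
        calc ‖y - z‖ = ‖(y - c) - (z - c)‖ := by congr 1; abel
          _ ≤ ‖y - c‖ + ‖z - c‖ := norm_sub_le _ _
          _ < 3 * r := by linarith
      · intro hy
        refine ⟨hy.1, mem_ball_iff_norm.2 ?_⟩
        have := hbc ω z h1 y hy
        rw [h2] at this
        calc ‖y - 0‖ = ‖z - (z - y)‖ := by simp
          _ ≤ ‖z‖ + ‖z - y‖ := norm_sub_le _ _
          _ < 3 * r := by linarith
    calc z = b ω z := h2.symm
      _ = b ω 0 := by simp only [hb, hNN]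
  · filter_upwards [hθ.ae_measure_visits_ne_zero (m := m) hA hPA] with ω hω
    obtain ⟨D, hDc, hDd⟩ := TopologicalSpace.exists_countable_dense E
    have hex : ∃ q ∈ D, m (C ω ∩ Metric.ball q (r / 2)) ≠ 0 := by
      by_contra! h
      apply hω
      refine measure_mono_null (t := ⋃ q ∈ D, C ω ∩ Metric.ball q (r / 2)) ?_
        ((measure_biUnion_null_iff hDc).2 h)
      intro x hx
      obtain ⟨q, hq, hxq⟩ := hDd.exists_dist_lt x (half_pos hr0)
      exact mem_biUnion hq ⟨hx, hxq⟩
    obtain ⟨q, -, hq⟩ := hex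
    obtain ⟨x, hxC, hxq⟩ := nonempty_of_measure_ne_zero hq
    have h1 : m (N ω x) ≠ 0 := by
      have hsub : C ω ∩ Metric.ball q (r / 2) ⊆ N ω x := by
        intro y hy
        refine ⟨hy.1, ?_⟩
        have h2 := hy.2
        rw [Metric.mem_ball] at *
        linarith [dist_triangle_right y x q]
      exact fun h => hq (measure_mono_null hsub h)
    have hxN : x ∈ N ω x := ⟨hxC, Metric.mem_ball_self (by positivity)⟩
    set z := b ω x with hz
    have hzx : ‖z - x‖ ≤ r := hbc ω x h1 x hxN
    have hNN : N ω z = N ω x := by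
      ext y
      constructor
      · intro hy
        have hyz := mem_ball_iff_norm.1 hy.2
        refine ⟨hy.1, mem_ball_iff_norm.2 ?_⟩
        have : ‖y - x‖ < r := hclose ω x hxC y hy.1 (by
          calc ‖y - x‖ = ‖(y - z) + (z - x)‖ := by congr 1; abel
            _ ≤ ‖y - z‖ + ‖z - x‖ := norm_add_le _ _
            _ ≤ 6 * r := by linarith)
        linarith
      · intro hy
        have hyx := mem_ball_iff_norm.1 hy.2
        refine ⟨hy.1, mem_ball_iff_norm.2 ?_⟩
        have : ‖y - x‖ < r := hclose ω x hxC y hy.1 (by linarith)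
        calc ‖y - z‖ = ‖(y - x) - (z - x)‖ := by congr 1; abel
          _ ≤ ‖y - x‖ + ‖z - x‖ := norm_sub_le _ _
          _ < 3 * r := by linarith
    refine ⟨z, ?_, ?_⟩
    · rw [hmshift, hNN]
      exact h1
    · rw [hbshift _ _ (by rwa [hNN]), sub_eq_zero]
      simp only [hb, hNN]
      exact hz.symm

end Section

end IsErgodicFlow

/-- A kernel that is finite on the members of a countable measurable cover is s-finite. -/
lemma isSFiniteKernel_of_cover {X E : Type*} [MeasurableSpace X] [MeasurableSpace E]
    (κ : Kernel X E) {s : ℕ → Set E} (hs : ∀ n, MeasurableSet (s n)) (hU : ⋃ n, s n = univ)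
    (hfin : ∀ x n, κ x (s n) < ⊤) : IsSFiniteKernel κ := by
  have ht : ∀ n, MeasurableSet (disjointed s n) := fun n => MeasurableSet.disjointed hs n
  have htfin : ∀ x n, κ x (disjointed s n) < ⊤ := fun x n =>
    (measure_mono (disjointed_subset s n)).trans_lt (hfin x n)
  have hv : ∀ n m : ℕ, MeasurableSet {x | κ x (disjointed s n) ∈ Ico (m : ℝ≥0∞) (m + 1)} :=
    fun n m => (κ.measurable_coe (ht n)) measurableSet_Ico
  classical
  set k : ℕ → ℕ → Kernel X E := fun n m => Kernel.piecewise (hv n m) (κ.restrict (ht n)) 0 with hk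
  have hkfin : ∀ n m, IsFiniteKernel (k n m) := by
    intro n m
    refine ⟨⟨m + 1, by simp, fun x => ?_⟩⟩
    rw [hk, Kernel.piecewise_apply]
    split_ifs with hx
    · rw [Kernel.restrict_apply, Measure.restrict_apply_univ]
      exact hx.2.le
    · simp
  have hsum : κ = Kernel.sum fun n => Kernel.sum fun m => k n m := by
    ext x B hB
    rw [Kernel.sum_apply' _ _ hB]
    have h1 : ∀ n, Kernel.sum (fun m => k n m) x B = κ x (B ∩ disjointed s n) := by
      intro n
      rw [Kernel.sum_apply' _ _ hB]
      set a := (κ x (disjointed s n)).toNNReal with ha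
      have haa : κ x (disjointed s n) = a := (ENNReal.coe_toNNReal (htfin x n).ne).symm
      have hmem : ∀ m : ℕ, x ∈ {x | κ x (disjointed s n) ∈ Ico (m : ℝ≥0∞) (m + 1)} ↔ m = ⌊a⌋₊ := by
        intro m
        simp only [mem_ofPred_eq, haa, mem_Ico]
        rw [eq_comm, Nat.floor_eq_iff zero_le]
        norm_cast
      rw [tsum_eq_single ⌊a⌋₊]
      · rw [hk]
        simp only [Kernel.piecewise_apply, (hmem _).2 rfl, if_true]
        rw [Kernel.restrict_apply' _ _ _ hB]
      · intro m hm
        rw [hk]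
        simp only [Kernel.piecewise_apply, (hmem m).not.2 hm, if_false]
        simp
    simp only [h1]
    rw [← measure_iUnion, ← inter_iUnion, iUnion_disjointed, hU, inter_univ]
    · intro i j hij
      exact (disjoint_disjointed s hij).mono inter_subset_right inter_subset_right
    · exact fun n => hB.inter (ht n)
  rw [hsum]
  infer_instance

/-- A kernel whose values are equivariant and finite on compact sets. -/
structure IsEquivariant {E Ω : Type*} [AddCommGroup E] [TopologicalSpace E] [MeasurableSpace E]
    [MeasurableSpace Ω] (θ : E → Ω → Ω) (ξ : Kernel Ω E) : Prop where
  shift : ∀ ω x, ξ (θ x ω) = (ξ ω).map (fun y => y - x)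
  lt_top : ∀ ω K, IsCompact K → ξ ω K < ⊤

section

variable {E Ω : Type*} [NormedAddCommGroup E] [NormedSpace ℝ E] [FiniteDimensional ℝ E]
  [MeasurableSpace E] [BorelSpace E] [MeasurableSpace Ω] {θ : E → Ω → Ω} {P : Measure Ω}
  {ξ : Kernel Ω E}

lemma IsEquivariant.isSFiniteKernel (hξ : IsEquivariant θ ξ) : IsSFiniteKernel ξ := by
  have : ProperSpace E := FiniteDimensional.proper ℝ E
  exact isSFiniteKernel_of_cover ξ (s := fun n : ℕ => Metric.closedBall 0 n)
    (fun n => measurableSet_closedBall) (Metric.iUnion_closedBall_nat 0)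
    fun ω n => hξ.lt_top ω _ (isCompact_closedBall _ _)

lemma IsEquivariant.shift_apply (hξ : IsEquivariant θ ξ) (ω : Ω) (x : E) {B : Set E}
    (hB : MeasurableSet B) : ξ (θ x ω) B = ξ ω {y | y - x ∈ B} := by
  rw [hξ.shift]
  exact Measure.map_apply (measurable_id.sub_const x) hB

/-- The Campbell measure of `ξ`. -/
def campbell (θ : E → Ω → Ω) (P : Measure Ω) (ξ : Kernel Ω E) : Measure (Ω × E) :=
  (P ⊗ₘ ξ).map fun p => (θ p.2 p.1, p.2)

lemma IsErgodicFlow.measurable_pair (hθ : IsErgodicFlow θ P) :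
    Measurable fun p : Ω × E => (θ p.2 p.1, p.2) :=
  (hθ.measurable.comp measurable_swap).prodMk measurable_snd

lemma campbell_apply [SFinite P] [IsSFiniteKernel ξ] (hθ : IsErgodicFlow θ P) {S : Set (Ω × E)}
    (hS : MeasurableSet S) : campbell θ P ξ S = ∫⁻ ω, ξ ω {x | (θ x ω, x) ∈ S} ∂P := by
  rw [campbell, Measure.map_apply hθ.measurable_pair hS,
    Measure.compProd_apply (hθ.measurable_pair hS)]
  rfl

lemma campbell_eq_prod [IsProbabilityMeasure P] (hθ : IsErgodicFlow θ P) (hξ : IsEquivariant θ ξ)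
    (hfin : ∀ K, IsCompact K → ∫⁻ ω, ξ ω K ∂P < ⊤) :
    ∃ Q : Measure Ω, IsFiniteMeasure Q ∧
      campbell θ P ξ = Q.prod (Measure.addHaar : Measure E) := by
  have : ProperSpace E := FiniteDimensional.proper ℝ E
  have := hξ.isSFiniteKernel
  set l : Measure E := Measure.addHaar with hl
  set m : Set Ω → Measure E := fun A => ((campbell θ P ξ).restrict (A ×ˢ univ)).map Prod.snd with hm
  have hmA : ∀ A B, MeasurableSet B → m A B = campbell θ P ξ (A ×ˢ B) := by
    intro A B hB
    rw [hm]
    simp only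
    rw [Measure.map_apply measurable_snd hB, Measure.restrict_apply (measurable_snd hB)]
    congr 1
    ext p
    simp [and_comm]
  have hinv : ∀ A, MeasurableSet A → (m A).IsAddLeftInvariant := by
    intro A hA
    refine ⟨fun v => ?_⟩
    ext B hB
    have hB' : MeasurableSet {x | v + x ∈ B} := (measurable_const_add v) hB
    rw [Measure.map_apply (measurable_const_add v) hB, hmA _ _ hB]
    refine (hmA _ _ hB').trans ?_
    rw [campbell_apply hθ (hA.prod hB), campbell_apply hθ (hA.prod hB')]
    have hS : MeasurableSet {p : Ω × E | θ p.2 p.1 ∈ A ∧ v + p.2 ∈ B} :=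
      hθ.measurable_pair (hA.prod hB')
    have hF : Measurable fun ω => ξ ω {x | θ x ω ∈ A ∧ v + x ∈ B} :=
      Kernel.measurable_kernel_prodMk_left hS
    have h := (hθ.preserving v).lintegral_comp hF
    refine h.symm.trans (lintegral_congr fun ω => ?_)
    have hSω : MeasurableSet {x | θ x (θ v ω) ∈ A ∧ v + x ∈ B} :=
      (measurable_prodMk_left (x := θ v ω)) hS
    refine (hξ.shift_apply ω v hSω).trans ?_
    congr 1
    ext x
    simp [hθ.add]
  have hloc : ∀ A, IsFiniteMeasureOnCompacts (m A) := by
    refine fun A => ⟨fun K hK => ?_⟩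
    rw [hmA _ _ hK.measurableSet]
    refine (measure_mono (prod_mono_left (subset_univ A))).trans_lt ?_
    rw [campbell_apply hθ (MeasurableSet.univ.prod hK.measurableSet)]
    simpa using hfin K hK
  set b : Set E := Metric.closedBall 0 1 with hb
  have hb0 : l b ≠ 0 := (Metric.measure_closedBall_pos l 0 one_pos).ne'
  have hbt : l b ≠ ⊤ := measure_closedBall_lt_top.ne
  set Q : Measure Ω := (l b)⁻¹ • ((campbell θ P ξ).restrict (univ ×ˢ b)).map Prod.fst with hQ
  have hQA : ∀ A, MeasurableSet A → Q A = (l b)⁻¹ * m A b := by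
    intro A hA
    rw [hQ, Measure.smul_apply, Measure.map_apply measurable_fst hA,
      Measure.restrict_apply (measurable_fst hA), hmA _ _ measurableSet_closedBall, smul_eq_mul]
    congr 2
    ext p
    simp [hb]
  have hQfin : IsFiniteMeasure Q := by
    refine ⟨?_⟩
    rw [hQA _ MeasurableSet.univ]
    have := hloc univ
    exact ENNReal.mul_lt_top (by simpa [pos_iff_ne_zero] using hb0) measure_closedBall_lt_top
  refine ⟨Q, hQfin, (Measure.prod_eq fun A B hA hB => ?_).symm⟩
  have := hinv A hA
  have := hloc A
  have hml : m A = Measure.addHaarScalarFactor (m A) l • l :=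
    Measure.isAddLeftInvariant_eq_smul (m A) l
  rw [hQA A hA, ← hmA A B hB, hml]
  simp only [Measure.smul_apply, ENNReal.smul_def, smul_eq_mul]
  generalize (Measure.addHaarScalarFactor (m A) l : ℝ≥0∞) = c
  rw [show (l b)⁻¹ * (c * l b) * l B = c * l B * (l b * (l b)⁻¹) by ring,
    ENNReal.mul_inv_cancel hb0 hbt, mul_one]

/-- Mass transport: a measurable equivariant displacement preserves the mean mass. -/
lemma lintegral_displacement [IsProbabilityMeasure P] (hθ : IsErgodicFlow θ P)
    (hξ : IsEquivariant θ ξ) (hfin : ∀ K, IsCompact K → ∫⁻ ω, ξ ω K ∂P < ⊤) {A : Set Ω}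
    (hA : MeasurableSet A) {τ : Ω → E} (hτ : Measurable τ) {B : Set E} (hB : MeasurableSet B) :
    ∫⁻ ω, ξ ω {x | θ x ω ∈ A ∧ x + τ (θ x ω) ∈ B} ∂P = ∫⁻ ω, ξ ω {x | θ x ω ∈ A ∧ x ∈ B} ∂P := by
  have := hξ.isSFiniteKernel
  obtain ⟨Q, hQ, hc⟩ := campbell_eq_prod hθ hξ hfin
  have h1 : MeasurableSet {p : Ω × E | p.1 ∈ A ∧ p.2 + τ p.1 ∈ B} := by
    have ha : MeasurableSet {p : Ω × E | p.1 ∈ A} := measurable_fst hA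
    have hb : MeasurableSet {p : Ω × E | p.2 + τ p.1 ∈ B} :=
      (measurable_snd.add (hτ.comp measurable_fst)) hB
    exact ha.inter hb
  have h2 : MeasurableSet {p : Ω × E | p.1 ∈ A ∧ p.2 ∈ B} := hA.prod hB
  have e1 := campbell_apply (ξ := ξ) hθ h1
  have e2 := campbell_apply (ξ := ξ) hθ h2
  refine e1.symm.trans (Eq.trans ?_ e2)
  rw [hc, Measure.prod_apply h1, Measure.prod_apply h2]
  refine lintegral_congr fun ω => ?_
  by_cases hω : ω ∈ A
  · simp only [preimage_ofPred_eq, hω, true_and]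
    exact measure_preimage_add_right _ (τ ω) B
  · simp [hω]

end

/-- Restriction of a kernel to the sections of a measurable set. -/
def restrictSection {X E : Type*} [MeasurableSpace X] [MeasurableSpace E] (κ : Kernel X E)
    [IsSFiniteKernel κ] (t : Set (X × E)) (ht : MeasurableSet t) : Kernel X E where
  toFun x := (κ x).restrict {y | (x, y) ∈ t}
  measurable' := by
    refine Measure.measurable_of_measurable_coe _ fun s hs => ?_
    have hts : MeasurableSet {p : X × E | p.2 ∈ s ∧ p ∈ t} := (measurable_snd hs).inter ht
    have h : Measurable fun x => κ x {y | y ∈ s ∧ (x, y) ∈ t} :=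
      Kernel.measurable_kernel_prodMk_left hts
    exact (congrArg Measurable (funext fun x => Measure.restrict_apply hs)).mpr h

lemma restrictSection_apply {X E : Type*} [MeasurableSpace X] [MeasurableSpace E] (κ : Kernel X E)
    [IsSFiniteKernel κ] {t : Set (X × E)} (ht : MeasurableSet t) (x : X) :
    restrictSection κ t ht x = (κ x).restrict {y | (x, y) ∈ t} := rfl

section

variable {E Ω : Type*} [NormedAddCommGroup E] [NormedSpace ℝ E] [FiniteDimensional ℝ E]
  [MeasurableSpace E] [BorelSpace E] [MeasurableSpace Ω] {θ : E → Ω → Ω} {P : Measure Ω}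
  {ξ η : Kernel Ω E} {U : Set Ω} {l : Ω → E} {ρ : ℝ}

/-- Position of a point relative to the section point found near `-v`. -/
def relPos (θ : E → Ω → Ω) (l : Ω → E) (v : E) (ω : Ω) : E := v - l (θ (-v) ω)

/-- The section point found near `-v`, with the relative position of the origin. -/
def basePair (θ : E → Ω → Ω) (l : Ω → E) (v : E) (ω : Ω) : Ω × E :=
  (θ (-relPos θ l v ω) ω, relPos θ l v ω)

/-- There is a section point near `-v`. -/
def nearSection (θ : E → Ω → Ω) (l : Ω → E) (U : Set Ω) (ρ : ℝ) (v : E) : Set Ω :=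
  {ω | ‖relPos θ l v ω - v‖ < ρ ∧ θ (-relPos θ l v ω) ω ∈ U}

lemma measurable_basePair (hθ : IsErgodicFlow θ P) (hlm : Measurable l) (v : E) :
    Measurable (basePair θ l v) := by
  have h : Measurable (relPos θ l v) := (hlm.comp (hθ.measurable_right (-v))).const_sub v
  exact (hθ.measurable.comp (h.neg.prodMk measurable_id)).prodMk h

lemma measurableSet_nearSection (hθ : IsErgodicFlow θ P) (hlm : Measurable l)
    (hU : MeasurableSet U) (v : E) : MeasurableSet (nearSection θ l U ρ v) := by
  have h := measurable_basePair hθ hlm v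
  have h1 : MeasurableSet {ω | ‖relPos θ l v ω - v‖ < ρ} :=
    measurableSet_lt (h.snd.sub_const v).norm measurable_const
  have h2 : MeasurableSet {ω | θ (-relPos θ l v ω) ω ∈ U} := h.fst hU
  exact h1.inter h2

lemma relPos_eq (hθ : IsErgodicFlow θ P) (hl : ∀ ω z, ‖z‖ < ρ → θ z ω ∈ U → z = l ω)
    {ω : Ω} {x z v : E} (hz : θ z ω ∈ U) (hx : ‖x - z - v‖ < ρ) :
    relPos θ l v (θ x ω) = x - z := by
  have h : z - x + v = l (θ (-v) (θ x ω)) := by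
    refine hl _ _ ?_ ?_
    · rwa [← norm_neg, show -(z - x + v) = x - z - v by abel]
    · rw [hθ.add, hθ.add]
      convert hz using 2
      abel
  rw [relPos, ← h]
  abel

lemma basePair_eq (hθ : IsErgodicFlow θ P) (hl : ∀ ω z, ‖z‖ < ρ → θ z ω ∈ U → z = l ω)
    {ω : Ω} {x z v : E} (hz : θ z ω ∈ U) (hx : ‖x - z - v‖ < ρ) :
    basePair θ l v (θ x ω) = (θ z ω, x - z) := by
  rw [basePair, relPos_eq hθ hl hz hx, hθ.add]
  congr 2
  abel

lemma mem_nearSection_iff (hθ : IsErgodicFlow θ P)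
    (hl : ∀ ω z, ‖z‖ < ρ → θ z ω ∈ U → z = l ω) {ω : Ω} {x v : E} :
    θ x ω ∈ nearSection θ l U ρ v ↔ ∃ z, θ z ω ∈ U ∧ ‖x - z - v‖ < ρ := by
  constructor
  · rintro ⟨h1, h2⟩
    refine ⟨x - relPos θ l v (θ x ω), ?_, ?_⟩
    · rwa [hθ.add, ← sub_eq_add_neg] at h2
    · rwa [sub_sub_cancel]
  · rintro ⟨z, hz, hx⟩
    have h := relPos_eq hθ hl hz hx
    refine ⟨by rwa [h], ?_⟩
    rw [h, hθ.add]
    convert hz using 2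
    abel

lemma countable_visits (hθ : IsErgodicFlow θ P) (hρ : 0 < ρ)
    (hl : ∀ ω z, ‖z‖ < ρ → θ z ω ∈ U → z = l ω) (ω : Ω) : {z | θ z ω ∈ U}.Countable := by
  obtain ⟨D, hDc, hDd⟩ := TopologicalSpace.exists_countable_dense E
  refine (hDc.image fun d => d + l (θ d ω)).mono fun z hz => ?_
  obtain ⟨d, hd, hzd⟩ := hDd.exists_dist_lt z hρ
  refine ⟨d, hd, ?_⟩
  simp only
  rw [← hl (θ d ω) (z - d) (by rwa [← dist_eq_norm]) (by rwa [hθ.add, add_sub_cancel]),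
    add_sub_cancel]

lemma measure_iUnion_cells (hθ : IsErgodicFlow θ P) (hξ : IsEquivariant θ ξ) (hρ : 0 < ρ)
    (hl : ∀ ω z, ‖z‖ < ρ → θ z ω ∈ U → z = l ω) (ω : Ω) (v : E) (C : E → Set E)
    (hC : ∀ z, MeasurableSet (C z)) (hCv : ∀ z, ∀ y ∈ C z, ‖y - v‖ < ρ) :
    ξ ω {x | ∃ z, θ z ω ∈ U ∧ x - z ∈ C z} = ∑' z : {z | θ z ω ∈ U}, ξ (θ z ω) (C z) := by
  have hset : {x | ∃ z, θ z ω ∈ U ∧ x - z ∈ C z} =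
      ⋃ z ∈ {z | θ z ω ∈ U}, {x | x - z ∈ C z} := by
    ext x
    simp
  rw [hset, measure_biUnion (countable_visits hθ hρ hl ω)]
  · exact tsum_congr fun z => (hξ.shift_apply ω z (hC z)).symm
  · intro z hz z' hz' hne
    refine disjoint_left.2 fun x hx hx' => hne ?_
    have h1 := relPos_eq hθ hl hz (hCv _ _ hx)
    have h2 := relPos_eq hθ hl hz' (hCv _ _ hx')
    exact sub_right_injective (h1.symm.trans h2)
  · exact fun z _ => (measurable_id.sub_const z) (hC z)

lemma IsEquivariant.singleton_eq_zero (hξ : IsEquivariant θ ξ) {ω : Ω} (h : ∀ x, ξ ω {x} = 0)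
    (z x : E) : ξ (θ z ω) {x} = 0 := by
  rw [hξ.shift_apply ω z (measurableSet_singleton x)]
  refine Eq.trans ?_ (h (x + z))
  congr 1
  ext y
  simp [sub_eq_iff_eq_add]

/-- One step of the matching: the part of `ξ` at position `v₁` from the section is matched with the
part of `η` at position `v₂`, exhausting one of the two. -/
theorem exists_matching_step (hθ : IsErgodicFlow θ P) (hξ : IsEquivariant θ ξ)
    (hη : IsEquivariant θ η) (hρ : 0 < ρ) (hU : MeasurableSet U) (hlm : Measurable l)
    (hl : ∀ ω z, ‖z‖ < ρ → θ z ω ∈ U → z = l ω) {A₀ B₀ : Set Ω} (hA₀ : MeasurableSet A₀)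
    (hB₀ : MeasurableSet B₀) (v₁ v₂ : E) :
    ∃ (A B : Set Ω) (τ : Ω → E), MeasurableSet A ∧ MeasurableSet B ∧ Measurable τ ∧
      A ⊆ A₀ ∧ B ⊆ B₀ ∧ ∀ ω, (∀ x, ξ ω {x} = 0) → (∀ x, η ω {x} = 0) →
        (∀ S, MeasurableSet S → ξ ω {x | θ x ω ∈ A ∧ x + τ (θ x ω) ∈ S} =
          η ω {x | θ x ω ∈ B ∧ x ∈ S}) ∧
        ∀ z, θ z ω ∈ U → ξ ω {x | ‖x - z - v₁‖ < ρ ∧ θ x ω ∈ A₀ \ A} = 0 ∨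
          η ω {x | ‖x - z - v₂‖ < ρ ∧ θ x ω ∈ B₀ \ B} = 0 := by
  have : ProperSpace E := FiniteDimensional.proper ℝ E
  have := hξ.isSFiniteKernel
  have := hη.isSFiniteKernel
  have hcell : ∀ (v : E) {A : Set Ω}, MeasurableSet A →
      MeasurableSet {p : Ω × E | ‖p.2 - v‖ < ρ ∧ θ p.2 p.1 ∈ A} := fun v A hA => by
    have h1 : MeasurableSet {p : Ω × E | ‖p.2 - v‖ < ρ} :=
      measurableSet_lt (measurable_snd.sub_const v).norm measurable_const
    have h2 : MeasurableSet {p : Ω × E | θ p.2 p.1 ∈ A} := (hθ.measurable.comp measurable_swap) hA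
    exact h1.inter h2
  have hfin : ∀ {κ : Kernel Ω E}, IsEquivariant θ κ → ∀ ω v (A : Set Ω),
      IsFiniteMeasure ((κ ω).restrict {y | ‖y - v‖ < ρ ∧ θ y ω ∈ A}) := by
    intro κ hκ ω v A
    refine ⟨?_⟩
    rw [Measure.restrict_apply_univ]
    have hsub : {y | ‖y - v‖ < ρ ∧ θ y ω ∈ A} ⊆ Metric.closedBall v ρ :=
      fun y hy => mem_closedBall_iff_norm.2 hy.1.le
    exact (measure_mono hsub).trans_lt (hκ.lt_top _ _ (isCompact_closedBall _ _))
  set μ := restrictSection ξ _ (hcell v₁ hA₀) with hμ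
  set ν := restrictSection η _ (hcell v₂ hB₀) with hν
  have hμfin : ∀ ω, IsFiniteMeasure (μ ω) := fun ω => hfin hξ ω v₁ A₀
  have hνfin : ∀ ω, IsFiniteMeasure (ν ω) := fun ω => hfin hη ω v₂ B₀
  have : IsSFiniteKernel μ := isSFiniteKernel_of_cover μ (s := fun _ => univ)
    (fun _ => MeasurableSet.univ) (iUnion_const _) fun ω _ => measure_lt_top _ _
  have : IsSFiniteKernel ν := isSFiniteKernel_of_cover ν (s := fun _ => univ)
    (fun _ => MeasurableSet.univ) (iUnion_const _) fun ω _ => measure_lt_top _ _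
  obtain ⟨a, b, t, ha, hb, ht, hmatch⟩ := exists_kernel_matching μ ν hμfin hνfin
  have hbase := fun v => measurable_basePair hθ hlm v
  have hnear := fun v => measurableSet_nearSection (ρ := ρ) hθ hlm hU v
  set A : Set Ω := A₀ ∩ (nearSection θ l U ρ v₁ ∩ basePair θ l v₁ ⁻¹' a) with hA
  set B : Set Ω := B₀ ∩ (nearSection θ l U ρ v₂ ∩ basePair θ l v₂ ⁻¹' b) with hB
  refine ⟨A, B, fun ω => t (basePair θ l v₁ ω) - (basePair θ l v₁ ω).2,
    hA₀.inter ((hnear v₁).inter (hbase v₁ ha)), hB₀.inter ((hnear v₂).inter (hbase v₂ hb)),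
    (ht.comp (hbase v₁)).sub (hbase v₁).snd, inter_subset_left, inter_subset_left, ?_⟩
  intro ω hω hω'
  have hμ0 : ∀ z y, μ (θ z ω) {y} = 0 := fun z y => by
    rw [hμ, restrictSection_apply]
    exact le_antisymm ((Measure.restrict_apply_le _ _).trans
      (hξ.singleton_eq_zero hω z y).le) zero_le
  have hν0 : ∀ z y, ν (θ z ω) {y} = 0 := fun z y => by
    rw [hν, restrictSection_apply]
    exact le_antisymm ((Measure.restrict_apply_le _ _).trans
      (hη.singleton_eq_zero hω' z y).le) zero_le
  have hm := fun z => hmatch (θ z ω) (hμ0 z) (hν0 z)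
  have hsec : ∀ (v : E) {A : Set Ω}, MeasurableSet A → ∀ ω,
      MeasurableSet {y | ‖y - v‖ < ρ ∧ θ y ω ∈ A} := fun v A hA ω =>
    measurable_prodMk_left (x := ω) (hcell v hA)
  have hasec : ∀ z, MeasurableSet {y | (θ z ω, y) ∈ a} := fun z => measurable_prodMk_left ha
  have hbsec : ∀ z, MeasurableSet {y | (θ z ω, y) ∈ b} := fun z => measurable_prodMk_left hb
  have htsec : ∀ z, Measurable fun y => t (θ z ω, y) := fun z => ht.comp measurable_prodMk_left
  constructor
  · intro S hS
    have hSsec : ∀ z, MeasurableSet {w | w + z ∈ S} := fun z => (measurable_add_const z) hS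
    have e1 : {x | θ x ω ∈ A ∧ x + (t (basePair θ l v₁ (θ x ω)) - (basePair θ l v₁ (θ x ω)).2) ∈ S}
        = {x | ∃ z, θ z ω ∈ U ∧ x - z ∈ {y | t (θ z ω, y) + z ∈ S ∧ (θ z ω, y) ∈ a ∧
          ‖y - v₁‖ < ρ ∧ θ y (θ z ω) ∈ A₀}} := by
      ext x
      constructor
      · rintro ⟨⟨h0, h1, h2⟩, h3⟩
        obtain ⟨z, hz, hx⟩ := (mem_nearSection_iff hθ hl).1 h1
        rw [mem_preimage, basePair_eq hθ hl hz hx] at h2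
        rw [basePair_eq hθ hl hz hx] at h3
        refine ⟨z, hz, ?_, h2, hx, by rwa [hθ.add, add_sub_cancel]⟩
        convert h3 using 1
        simp only
        abel
      · rintro ⟨z, hz, h3, h2, hx, h0⟩
        rw [hθ.add, add_sub_cancel] at h0
        refine ⟨⟨h0, (mem_nearSection_iff hθ hl).2 ⟨z, hz, hx⟩, ?_⟩, ?_⟩
        · rwa [mem_preimage, basePair_eq hθ hl hz hx]
        · rw [basePair_eq hθ hl hz hx]
          convert h3 using 1
          simp only
          abel
    have e2 : {x | θ x ω ∈ B ∧ x ∈ S}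
        = {x | ∃ z, θ z ω ∈ U ∧ x - z ∈ {y | y + z ∈ S ∧ (θ z ω, y) ∈ b ∧
          ‖y - v₂‖ < ρ ∧ θ y (θ z ω) ∈ B₀}} := by
      ext x
      constructor
      · rintro ⟨⟨h0, h1, h2⟩, h3⟩
        obtain ⟨z, hz, hx⟩ := (mem_nearSection_iff hθ hl).1 h1
        rw [mem_preimage, basePair_eq hθ hl hz hx] at h2
        exact ⟨z, hz, by rwa [sub_add_cancel], h2, hx,
          by rwa [hθ.add, add_sub_cancel]⟩
      · rintro ⟨z, hz, h3, h2, hx, h0⟩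
        rw [hθ.add, add_sub_cancel] at h0
        refine ⟨⟨h0, (mem_nearSection_iff hθ hl).2 ⟨z, hz, hx⟩, ?_⟩, ?_⟩
        · rwa [mem_preimage, basePair_eq hθ hl hz hx]
        · rwa [sub_add_cancel] at h3
    have m1 : ∀ z, MeasurableSet {y | t (θ z ω, y) + z ∈ S ∧ (θ z ω, y) ∈ a ∧
          ‖y - v₁‖ < ρ ∧ θ y (θ z ω) ∈ A₀} := fun z =>
      ((htsec z) (hSsec z)).inter ((hasec z).inter (hsec v₁ hA₀ (θ z ω)))
    have m2 : ∀ z, MeasurableSet {y | y + z ∈ S ∧ (θ z ω, y) ∈ b ∧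
          ‖y - v₂‖ < ρ ∧ θ y (θ z ω) ∈ B₀} := fun z =>
      (hSsec z).inter ((hbsec z).inter (hsec v₂ hB₀ (θ z ω)))
    have f1 := measure_iUnion_cells hθ hξ hρ hl ω v₁ _ m1 fun z y hy => hy.2.2.1
    have f2 := measure_iUnion_cells hθ hη hρ hl ω v₂ _ m2 fun z y hy => hy.2.2.1
    refine (congrArg _ e1).trans (f1.trans (Eq.trans ?_ (f2.symm.trans (congrArg _ e2.symm))))
    refine tsum_congr fun z => ?_
    have h : Measure.map _ _ {w | w + (z : E) ∈ S} = _ := DFunLike.congr_fun (hm z).1 _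
    rw [Measure.map_apply (htsec z) (hSsec z), hμ, hν, restrictSection_apply,
      restrictSection_apply, Measure.restrict_apply ((htsec z) (hSsec z)),
      Measure.restrict_apply (hSsec z),
      Measure.restrict_apply (((htsec z) (hSsec z)).inter (hasec z)),
      Measure.restrict_apply ((hSsec z).inter (hbsec z)), inter_assoc, inter_assoc] at h
    exact h
  · intro z hz
    have key : ∀ {κ : Kernel Ω E} (hκ : IsEquivariant θ κ) {v : E} {A₀ : Set Ω} {a : Set (Ω × E)},
        MeasurableSet A₀ → MeasurableSet a →
        (κ (θ z ω)).restrict {y | ‖y - v‖ < ρ ∧ θ y (θ z ω) ∈ A₀} {y | (θ z ω, y) ∉ a} = 0 →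
        κ ω {x | ‖x - z - v‖ < ρ ∧
          θ x ω ∈ A₀ \ (A₀ ∩ (nearSection θ l U ρ v ∩ basePair θ l v ⁻¹' a))} = 0 := by
      intro κ hκ v A₀ a hA₀ ha h
      have hac : MeasurableSet {y | (θ z ω, y) ∉ a} := measurable_prodMk_left ha.compl
      rw [Measure.restrict_apply hac, hκ.shift_apply ω z (hac.inter (hsec v hA₀ _))] at h
      refine measure_mono_null ?_ h
      rintro x ⟨hx, h0, h1⟩
      refine ⟨fun h2 => h1 ⟨h0, (mem_nearSection_iff hθ hl).2 ⟨z, hz, hx⟩, ?_⟩, hx, ?_⟩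
      · rwa [mem_preimage, basePair_eq hθ hl hz hx]
      · rwa [hθ.add, add_sub_cancel]
    exact (hm z).2.imp (key hξ hA₀ ha) (key hη hB₀ hb)

end

section

variable {E Ω : Type*} [NormedAddCommGroup E] [NormedSpace ℝ E] [FiniteDimensional ℝ E]
  [MeasurableSpace E] [BorelSpace E] [MeasurableSpace Ω] {θ : E → Ω → Ω} {P : Measure Ω}
  {ξ η : Kernel Ω E}

lemma IsErgodicFlow.measurableSet_visits (hθ : IsErgodicFlow θ P) (ω : Ω) {A : Set Ω}
    (hA : MeasurableSet A) : MeasurableSet {x | θ x ω ∈ A} :=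
  hθ.measurable_left ω hA

lemma IsErgodicFlow.measurable_measure_visits (hθ : IsErgodicFlow θ P) [IsSFiniteKernel ξ]
    {A : Set Ω} (hA : MeasurableSet A) {S : Set E} (hS : MeasurableSet S) :
    Measurable fun ω => ξ ω {x | θ x ω ∈ A ∧ x ∈ S} := by
  have h : MeasurableSet {p : Ω × E | θ p.2 p.1 ∈ A ∧ p.2 ∈ S} :=
    ((hθ.measurable.comp measurable_swap) hA).inter (measurable_snd hS)
  exact Kernel.measurable_kernel_prodMk_left h

lemma ae_measure_compl_visits_eq_zero (hθ : IsErgodicFlow θ P) (hξ : IsEquivariant θ ξ)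
    (hfin : ∀ K, IsCompact K → ∫⁻ ω, ξ ω K ∂P < ⊤) {A : Set Ω} (hA : MeasurableSet A)
    (h : ∀ K, IsCompact K → ∫⁻ ω, ξ ω {x | θ x ω ∈ A ∧ x ∈ K} ∂P = ∫⁻ ω, ξ ω K ∂P) :
    ∀ᵐ ω ∂P, ξ ω {x | θ x ω ∉ A} = 0 := by
  have : ProperSpace E := FiniteDimensional.proper ℝ E
  have := hξ.isSFiniteKernel
  have hn : ∀ n : ℕ, ∀ᵐ ω ∂P, ξ ω {x | θ x ω ∉ A ∧ x ∈ Metric.closedBall (0 : E) n} = 0 := by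
    intro n
    set K := Metric.closedBall (0 : E) n with hK
    have hKc : IsCompact K := isCompact_closedBall _ _
    have hm1 : Measurable fun ω => ξ ω {x | θ x ω ∈ A ∧ x ∈ K} :=
      hθ.measurable_measure_visits hA hKc.measurableSet
    have hm2 : Measurable fun ω => ξ ω {x | θ x ω ∉ A ∧ x ∈ K} :=
      hθ.measurable_measure_visits hA.compl hKc.measurableSet
    have hadd : ∀ ω, ξ ω K = ξ ω {x | θ x ω ∈ A ∧ x ∈ K} + ξ ω {x | θ x ω ∉ A ∧ x ∈ K} := by
      intro ω
      rw [← measure_inter_add_sdiff K (hθ.measurableSet_visits ω hA)]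
      congr 2
      · exact inter_comm _ _
      · ext x
        exact and_comm
    have hsum : ∫⁻ ω, ξ ω K ∂P = ∫⁻ ω, ξ ω K ∂P + ∫⁻ ω, ξ ω {x | θ x ω ∉ A ∧ x ∈ K} ∂P := by
      conv_lhs => rw [lintegral_congr hadd]
      rw [lintegral_add_left hm1, h K hKc]
    have h0 : ∫⁻ ω, ξ ω {x | θ x ω ∉ A ∧ x ∈ K} ∂P = 0 := by
      conv_lhs at hsum => rw [← add_zero (∫⁻ ω, ξ ω K ∂P)]
      exact ((ENNReal.add_right_inj (hfin K hKc).ne).1 hsum).symm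
    exact (lintegral_eq_zero_iff hm2).1 h0
  filter_upwards [ae_all_iff.2 hn] with ω hω
  have hsub : {x | θ x ω ∉ A} ⊆ ⋃ n : ℕ, {x | θ x ω ∉ A ∧ x ∈ Metric.closedBall (0 : E) n} := by
    intro x hx
    obtain ⟨n, hn⟩ := exists_nat_ge ‖x‖
    exact mem_iUnion.2 ⟨n, hx, by simpa using hn⟩
  exact measure_mono_null hsub (measure_iUnion_null hω)

/-- Greedy matching along a section exhausts one of the two measures. -/
theorem exists_partial_matching (hθ : IsErgodicFlow θ P) (hξ : IsEquivariant θ ξ)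
    (hη : IsEquivariant θ η) {ρ : ℝ} {U : Set Ω} {l : Ω → E} (hρ : 0 < ρ) (hU : MeasurableSet U)
    (hlm : Measurable l) (hl : ∀ ω z, ‖z‖ < ρ → θ z ω ∈ U → z = l ω) :
    ∃ (A B : Set Ω) (τ : Ω → E), MeasurableSet A ∧ MeasurableSet B ∧ Measurable τ ∧
      ∀ ω, (∀ x, ξ ω {x} = 0) → (∀ x, η ω {x} = 0) →
        (∀ S, MeasurableSet S → ξ ω {x | θ x ω ∈ A ∧ x + τ (θ x ω) ∈ S} =
          η ω {x | θ x ω ∈ B ∧ x ∈ S}) ∧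
        ((∃ z, θ z ω ∈ U) → ξ ω {x | θ x ω ∉ A} = 0 ∨ η ω {x | θ x ω ∉ B} = 0) := by
  have hstep : ∀ (q : {A : Set Ω // MeasurableSet A} × {B : Set Ω // MeasurableSet B}) (v : E × E),
      _ := fun q v =>
    exists_matching_step hθ hξ hη hρ hU hlm hl q.1.2 q.2.2 v.1 v.2
  choose fA fB fτ hfA hfB hfτ hfA' hfB' hf using hstep
  set V : ℕ → E × E := TopologicalSpace.denseSeq (E × E) with hV
  let seq : ℕ → {A : Set Ω // MeasurableSet A} × {B : Set Ω // MeasurableSet B} := fun n =>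
    Nat.rec (⟨univ, MeasurableSet.univ⟩, ⟨univ, MeasurableSet.univ⟩)
      (fun n q => (⟨q.1.1 \ fA q (V n), q.1.2.diff (hfA q (V n))⟩,
        ⟨q.2.1 \ fB q (V n), q.2.2.diff (hfB q (V n))⟩)) n
  set A : ℕ → Set Ω := fun n => fA (seq n) (V n) with hA
  set B : ℕ → Set Ω := fun n => fB (seq n) (V n) with hB
  set τ : ℕ → Ω → E := fun n => fτ (seq n) (V n) with hτ
  set R : ℕ → Set Ω := fun n => (seq n).1.1 with hR
  set S : ℕ → Set Ω := fun n => (seq n).2.1 with hS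
  have hR0 : R 0 = univ := rfl
  have hS0 : S 0 = univ := rfl
  have hRs : ∀ n, R (n + 1) = R n \ A n := fun n => rfl
  have hSs : ∀ n, S (n + 1) = S n \ B n := fun n => rfl
  have hAm : ∀ n, MeasurableSet (A n) := fun n => hfA _ _
  have hBm : ∀ n, MeasurableSet (B n) := fun n => hfB _ _
  have hdisj : ∀ {A R : ℕ → Set Ω}, (∀ n, R (n + 1) = R n \ A n) → (∀ n, A n ⊆ R n) →
      Pairwise fun i j => Disjoint (A i) (A j) := by
    intro A R hRs hAR
    have hanti : Antitone R := antitone_nat_of_succ_le fun n => by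
      rw [hRs]
      exact sdiff_subset
    have hlt : ∀ i j, i < j → Disjoint (A i) (A j) := fun i j hij =>
      disjoint_left.2 fun ω hi hj => by
        have h := hanti (Nat.succ_le_of_lt hij) (hAR j hj)
        rw [Nat.succ_eq_add_one, hRs] at h
        exact h.2 hi
    intro i j hij
    rcases hij.lt_or_gt with h | h
    · exact hlt i j h
    · exact (hlt j i h).symm
  have hAd := hdisj hRs fun n => hfA' _ _
  have hBd := hdisj hSs fun n => hfB' _ _
  have hrem : ∀ {A R : ℕ → Set Ω}, R 0 = univ → (∀ n, R (n + 1) = R n \ A n) →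
      ∀ ω, ω ∉ ⋃ n, A n → ∀ n, ω ∈ R n \ A n := by
    intro A R h0 hs ω hω n
    have hωn : ∀ n, ω ∉ A n := fun n h => hω (mem_iUnion.2 ⟨n, h⟩)
    refine ⟨?_, hωn n⟩
    induction n with
    | zero => simp [h0]
    | succ n ih =>
      rw [hs]
      exact ⟨ih, hωn n⟩
  obtain ⟨T, hTm, hT⟩ := exists_measurable_piecewise A hAm τ (fun n => hfτ _ _) (by
    intro i j hij ω hω
    exact absurd hω.2 (disjoint_left.1 (hAd hij) hω.1))
  refine ⟨⋃ n, A n, ⋃ n, B n, T, MeasurableSet.iUnion hAm, MeasurableSet.iUnion hBm, hTm, ?_⟩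
  intro ω hω hω'
  have hn := fun n => hf (seq n) (V n) ω hω hω'
  constructor
  · intro C hC
    have e1 : {x | θ x ω ∈ ⋃ n, A n ∧ x + T (θ x ω) ∈ C} =
        ⋃ n, {x | θ x ω ∈ A n ∧ x + τ n (θ x ω) ∈ C} := by
      ext x
      simp only [mem_ofPred_eq, mem_iUnion]
      constructor
      · rintro ⟨⟨n, hn⟩, h⟩
        exact ⟨n, hn, by rwa [← hT n hn]⟩
      · rintro ⟨n, hn, h⟩
        exact ⟨⟨n, hn⟩, by rwa [hT n hn]⟩
    have e2 : {x | θ x ω ∈ ⋃ n, B n ∧ x ∈ C} = ⋃ n, {x | θ x ω ∈ B n ∧ x ∈ C} := by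
      ext x
      simp
    have m1 : ∀ n, MeasurableSet {x | θ x ω ∈ A n ∧ x + τ n (θ x ω) ∈ C} := fun n =>
      (hθ.measurableSet_visits ω (hAm n)).inter
        ((measurable_id.add ((hfτ _ _).comp (hθ.measurable_left ω))) hC)
    have m2 : ∀ n, MeasurableSet {x | θ x ω ∈ B n ∧ x ∈ C} := fun n =>
      (hθ.measurableSet_visits ω (hBm n)).inter hC
    rw [e1, e2, measure_iUnion _ m1, measure_iUnion _ m2]
    · exact tsum_congr fun n => (hn n).1 C hC
    · exact fun i j hij => disjoint_left.2 fun x hx hx' =>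
        disjoint_left.1 (hBd hij) hx.1 hx'.1
    · exact fun i j hij => disjoint_left.2 fun x hx hx' =>
        disjoint_left.1 (hAd hij) hx.1 hx'.1
  · rintro ⟨z, hz⟩
    by_contra! hcon
    obtain ⟨x, -, hx⟩ := exists_mem_forall_mem_nhdsWithin_pos_measure hcon.1
    obtain ⟨y, -, hy⟩ := exists_mem_forall_mem_nhdsWithin_pos_measure hcon.2
    obtain ⟨n, hnV⟩ := (TopologicalSpace.denseRange_denseSeq (E × E)).exists_dist_lt
      (x - z, y - z) hρ
    rw [Prod.dist_eq, max_lt_iff, dist_eq_norm, dist_eq_norm] at hnV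
    have hnhd : ∀ (x v : E) (s : Set E), ‖x - z - v‖ < ρ →
        {x | ‖x - z - v‖ < ρ} ∩ s ∈ 𝓝[s] x := by
      intro x v s h
      rw [inter_comm]
      exact inter_mem_nhdsWithin s ((isOpen_lt (by fun_prop) continuous_const).mem_nhds h)
    rcases (hn n).2 z hz with h | h
    · refine (hx _ (hnhd x _ _ hnV.1)).ne' (measure_mono_null ?_ h)
      rintro u ⟨h1, h2⟩
      exact ⟨h1, hrem hR0 hRs _ h2 n⟩
    · refine (hy _ (hnhd y _ _ hnV.2)).ne' (measure_mono_null ?_ h)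
      rintro u ⟨h1, h2⟩
      exact ⟨h1, hrem hS0 hSs _ h2 n⟩

/-- Balancing displacement for a flow that is locally free. -/
theorem exists_displacement_of_free {Y : Type*} [IsProbabilityMeasure P] [MetricSpace Y]
    [SecondCountableTopology Y] [MeasurableSpace Y] [BorelSpace Y] (hθ : IsErgodicFlow θ P)
    (hξ : IsEquivariant θ ξ) (hη : IsEquivariant θ η)
    (hfin : ∀ K, IsCompact K → ∫⁻ ω, ξ ω K ∂P < ⊤)
    (hint : ∀ K, IsCompact K → ∫⁻ ω, ξ ω K ∂P = ∫⁻ ω, η ω K ∂P)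
    (hξd : ∀ᵐ ω ∂P, ∀ x, ξ ω {x} = 0) (hηd : ∀ᵐ ω ∂P, ∀ x, η ω {x} = 0)
    {G : Ω → Y} (hG : Measurable G) (hGc : ∀ ω, Continuous fun v => G (θ v ω)) {ε : ℝ}
    (hε : 0 < ε) (hfree : ∀ᵐ ω ∂P, ∀ v, 0 < ‖v‖ → ‖v‖ ≤ ε → G (θ v ω) ≠ G ω) :
    ∃ τ : Ω → E, Measurable τ ∧ ∀ᵐ ω ∂P, (ξ ω).map (fun x => x + τ (θ x ω)) = η ω := by
  have := hξ.isSFiniteKernel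
  have := hη.isSFiniteKernel
  obtain ⟨ρ, hρ, U, l, hU, hlm, hl, hvis⟩ := hθ.exists_section hG hGc hε hfree
  obtain ⟨A, B, τ, hA, hB, hτ, hAB⟩ := exists_partial_matching hθ hξ hη hρ hU hlm hl
  have hfin' : ∀ K, IsCompact K → ∫⁻ ω, η ω K ∂P < ⊤ := fun K hK => by
    rw [← hint K hK]
    exact hfin K hK
  have hmass : ∀ K, IsCompact K → ∫⁻ ω, ξ ω {x | θ x ω ∈ A ∧ x ∈ K} ∂P =
      ∫⁻ ω, η ω {x | θ x ω ∈ B ∧ x ∈ K} ∂P := by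
    intro K hK
    rw [← lintegral_displacement hθ hξ hfin hA hτ hK.measurableSet]
    refine lintegral_congr_ae ?_
    filter_upwards [hξd, hηd] with ω h1 h2
    exact (hAB ω h1 h2).1 K hK.measurableSet
  have hfull : ∀ {κ : Kernel Ω E} {A : Set Ω}, MeasurableSet A →
      (∀ᵐ ω ∂P, κ ω {x | θ x ω ∉ A} = 0) → ∀ K,
      ∫⁻ ω, κ ω {x | θ x ω ∈ A ∧ x ∈ K} ∂P = ∫⁻ ω, κ ω K ∂P := by
    intro κ A hA h K
    refine lintegral_congr_ae ?_
    filter_upwards [h] with ω hω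
    have hset : {x | θ x ω ∈ A ∧ x ∈ K} = K ∩ {x | θ x ω ∈ A} := inter_comm _ _
    rw [hset]
    exact measure_inter_conull hω
  have hnull : (∀ᵐ ω ∂P, ξ ω {x | θ x ω ∉ A} = 0) ∧ ∀ᵐ ω ∂P, η ω {x | θ x ω ∉ B} = 0 := by
    have hmeas : Measurable fun ω => ξ ω {x | θ x ω ∉ A} := by
      have h := hθ.measurable_measure_visits (ξ := ξ) hA.compl MeasurableSet.univ
      simpa using h
    rcases hθ.ae_or_ae_not (p := fun ω => ξ ω {x | θ x ω ∉ A} = 0)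
      (hmeas (measurableSet_singleton 0)) (fun x ω h => by
        rw [← h]
        refine (hξ.shift_apply ω x (hθ.measurableSet_visits _ hA.compl)).trans ?_
        congr 1
        ext y
        simp [hθ.add]) with h | h
    · refine ⟨h, ae_measure_compl_visits_eq_zero hθ hη hfin' hB fun K hK => ?_⟩
      rw [← hmass K hK, hfull hA h K, hint K hK]
    · have h' : ∀ᵐ ω ∂P, η ω {x | θ x ω ∉ B} = 0 := by
        filter_upwards [h, hξd, hηd, hvis] with ω h h1 h2 h3
        exact ((hAB ω h1 h2).2 h3).resolve_left h
      refine ⟨ae_measure_compl_visits_eq_zero hθ hξ hfin hA fun K hK => ?_, h'⟩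
      rw [hmass K hK, hfull hB h' K, hint K hK]
  refine ⟨τ, hτ, ?_⟩
  filter_upwards [hnull.1, hnull.2, hξd, hηd] with ω h1 h2 h3 h4
  have hTm : Measurable fun x => x + τ (θ x ω) :=
    measurable_id.add (hτ.comp (hθ.measurable_left ω))
  ext S hS
  rw [Measure.map_apply hTm hS]
  have e1 : ξ ω ((fun x => x + τ (θ x ω)) ⁻¹' S) = ξ ω {x | θ x ω ∈ A ∧ x + τ (θ x ω) ∈ S} := by
    refine (measure_inter_conull (t := {x | θ x ω ∈ A}) h1).symm.trans ?_
    rw [inter_comm]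
    rfl
  have e2 : η ω S = η ω {x | θ x ω ∈ B ∧ x ∈ S} := by
    refine (measure_inter_conull (t := {x | θ x ω ∈ B}) h2).symm.trans ?_
    rw [inter_comm]
    rfl
  rw [e1, e2]
  exact (hAB ω h3 h4).1 S hS

end

section

variable {F : Type*} [NormedAddCommGroup F] [NormedSpace ℝ F] [FiniteDimensional ℝ F]
  [MeasurableSpace F] [BorelSpace F]

/-- Translation-invariant measures that agree on one bounded set with nonempty interior, where they
are finite, coincide. -/
lemma eq_of_isAddLeftInvariant_of_measure_eq (m n : Measure F) [m.IsAddLeftInvariant]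
    [n.IsAddLeftInvariant] {Q : Set F} (hQ : (interior Q).Nonempty) (hQb : Bornology.IsBounded Q)
    (h : m Q = n Q) (hn : n Q ≠ ⊤) : m = n := by
  have : ProperSpace F := FiniteDimensional.proper ℝ F
  have hfin : ∀ (k : Measure F) [k.IsAddLeftInvariant], k Q ≠ ⊤ → IsFiniteMeasureOnCompacts k := by
    intro k _ hk
    refine ⟨fun K hK => measure_lt_top_of_isCompact_of_isAddLeftInvariant (interior Q)
      isOpen_interior hQ ?_ hK⟩
    exact ((measure_mono interior_subset).trans_lt hk.lt_top).ne
  have := hfin m (h ▸ hn)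
  have := hfin n hn
  set l : Measure F := Measure.addHaar with hl
  have hm : m = Measure.addHaarScalarFactor m l • l := Measure.isAddLeftInvariant_eq_smul m l
  have hn : n = Measure.addHaarScalarFactor n l • l := Measure.isAddLeftInvariant_eq_smul n l
  have hlQ : l Q ≠ 0 := ((isOpen_interior.measure_pos l hQ).trans_le
    (measure_mono interior_subset)).ne'
  have hlQ' : l Q ≠ ⊤ := hQb.measure_lt_top.ne
  rw [hm, hn, Measure.smul_apply, Measure.smul_apply, ENNReal.smul_def, ENNReal.smul_def,
    smul_eq_mul, smul_eq_mul, ENNReal.mul_left_inj hlQ hlQ', ENNReal.coe_inj] at h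
  rw [hm, hn, h]

/-- Measures on a product that are invariant in the first coordinate coincide if they agree on the
sets `closedBall 0 1 ×ˢ A`. -/
lemma ext_of_invariant_fst {W : Type*} [MeasurableSpace W] {m n : Measure (F × W)}
    (hm : ∀ v, m.map (fun p => (v + p.1, p.2)) = m) (hn : ∀ v, n.map (fun p => (v + p.1, p.2)) = n)
    (hfin : n (Metric.closedBall 0 1 ×ˢ univ) ≠ ⊤)
    (h : ∀ A, MeasurableSet A → m (Metric.closedBall 0 1 ×ˢ A) = n (Metric.closedBall 0 1 ×ˢ A)) :
    m = n := by
  have : ProperSpace F := FiniteDimensional.proper ℝ F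
  have hsec : ∀ (k : Measure (F × W)) (A : Set W) (C : Set F), MeasurableSet C →
      (k.restrict (univ ×ˢ A)).map Prod.fst C = k (C ×ˢ A) := by
    intro k A C hC
    rw [Measure.map_apply measurable_fst hC, Measure.restrict_apply (measurable_fst hC)]
    congr 1
    ext p
    simp
  have hinv : ∀ {k : Measure (F × W)}, (∀ v, k.map (fun p => (v + p.1, p.2)) = k) →
      ∀ A, MeasurableSet A → ((k.restrict (univ ×ˢ A)).map Prod.fst).IsAddLeftInvariant := by
    intro k hk A hA
    refine ⟨fun v => ?_⟩
    ext C hC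
    have hvm : Measurable fun p : F × W => (v + p.1, p.2) :=
      (measurable_fst.const_add v).prodMk measurable_snd
    rw [Measure.map_apply (measurable_const_add v) hC, hsec _ _ _ hC,
      hsec _ _ _ ((measurable_const_add v) hC)]
    conv_rhs => rw [← hk v, Measure.map_apply hvm (hC.prod hA)]
    rfl
  have hrect : ∀ A, MeasurableSet A → ∀ C, MeasurableSet C → m (C ×ˢ A) = n (C ×ˢ A) := by
    intro A hA C hC
    have := hinv hm A hA
    have := hinv hn A hA
    have heq := eq_of_isAddLeftInvariant_of_measure_eq ((m.restrict (univ ×ˢ A)).map Prod.fst)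
      ((n.restrict (univ ×ˢ A)).map Prod.fst) (Q := Metric.closedBall 0 1)
      ⟨0, mem_interior_iff_mem_nhds.2 (Metric.closedBall_mem_nhds 0 one_pos)⟩
      Metric.isBounded_closedBall
      (by rw [hsec _ _ _ measurableSet_closedBall, hsec _ _ _ measurableSet_closedBall, h A hA])
      (by
        rw [hsec _ _ _ measurableSet_closedBall]
        exact ((measure_mono (prod_mono_right (subset_univ A))).trans_lt hfin.lt_top).ne)
    rw [← hsec m A C hC, ← hsec n A C hC, heq]
  have hballs : ∀ r : ℝ, n (Metric.closedBall 0 r ×ˢ univ) ≠ ⊤ := by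
    intro r
    have := hinv hn univ MeasurableSet.univ
    rw [← hsec n univ _ measurableSet_closedBall]
    refine (measure_lt_top_of_isCompact_of_isAddLeftInvariant (interior (Metric.closedBall 0 1))
      isOpen_interior ⟨0, mem_interior_iff_mem_nhds.2 (Metric.closedBall_mem_nhds 0 one_pos)⟩ ?_
      (isCompact_closedBall 0 r)).ne
    refine ((measure_mono interior_subset).trans_lt ?_).ne
    rw [hsec _ _ _ measurableSet_closedBall]
    exact hfin.lt_top
  refine Measure.ext_of_generateFrom_of_iUnion _ (fun k : ℕ => Metric.closedBall (0 : F) k ×ˢ univ)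
    generateFrom_prod.symm isPiSystem_prod ?_ (fun k => ⟨_, measurableSet_closedBall, _,
      MeasurableSet.univ, rfl⟩) (fun k => ?_) ?_
  · rw [← iUnion_prod_const, Metric.iUnion_closedBall_nat, univ_prod_univ]
  · rw [hrect _ MeasurableSet.univ _ measurableSet_closedBall]
    exact hballs k
  · rintro _ ⟨C, hC, A, hA, rfl⟩
    exact hrect A hA C hC

end

section

variable {E : Type*} [NormedAddCommGroup E] [InnerProductSpace ℝ E] [FiniteDimensional ℝ E]

/-- A closed subgroup contains a subspace in the orthogonal complement of which it is discrete. -/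
lemma exists_submodule_of_isClosed (H : AddSubgroup E) (hH : IsClosed (H : Set E)) :
    ∃ V : Submodule ℝ E, (∀ v ∈ V, v ∈ H) ∧ ∃ ε > 0, ∀ h ∈ H, h ∈ Vᗮ → ‖h‖ ≤ ε → h = 0 := by
  have : ProperSpace E := FiniteDimensional.proper ℝ E
  let V : Submodule ℝ E :=
    { carrier := {v | ∀ t : ℝ, t • v ∈ H}
      add_mem' := fun {a b} ha hb t => by
        rw [smul_add]
        exact H.add_mem (ha t) (hb t)
      zero_mem' := fun t => by simp
      smul_mem' := fun c v hv t => by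
        rw [smul_smul]
        exact hv _ }
  refine ⟨V, fun v hv => by simpa using hv 1, ?_⟩
  by_contra! hcon
  choose h hhH hhV hhn hh0 using fun n : ℕ => hcon (1 / ((n : ℝ) + 1)) (by positivity)
  have hpos : ∀ n, 0 < ‖h n‖ := fun n => norm_pos_iff.2 (hh0 n)
  have hlim : Tendsto (fun n => ‖h n‖) atTop (𝓝 0) :=
    squeeze_zero (fun n => norm_nonneg _) hhn tendsto_one_div_add_atTop_nhds_zero_nat
  obtain ⟨u, hu, φ, hφ, hφu⟩ := (isCompact_sphere (0 : E) 1).tendsto_subseq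
    (x := fun n => ‖h n‖⁻¹ • h n) fun n => by simp [norm_smul, (hpos n).ne']
  have huW : u ∈ Vᗮ := Vᗮ.closed_of_finiteDimensional.mem_of_tendsto hφu
    (Eventually.of_forall fun n => Vᗮ.smul_mem _ (hhV _))
  have huV : u ∈ V := by
    intro t
    have hlim' := hlim.comp hφ.tendsto_atTop
    have h1 : Tendsto (fun n => ((⌊t / ‖h (φ n)‖⌋ : ℝ) * ‖h (φ n)‖)) atTop (𝓝 t) := by
      have hlow : Tendsto (fun n => t - ‖h (φ n)‖) atTop (𝓝 t) := by
        simpa using tendsto_const_nhds.sub hlim'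
      refine tendsto_of_tendsto_of_tendsto_of_le_of_le hlow tendsto_const_nhds (fun n => ?_)
        fun n => ?_
      · have := (Int.sub_one_lt_floor (t / ‖h (φ n)‖)).le
        have h2 := mul_le_mul_of_nonneg_right this (hpos (φ n)).le
        rwa [sub_mul, div_mul_cancel₀ _ (hpos (φ n)).ne', one_mul] at h2
      · have h2 := mul_le_mul_of_nonneg_right (Int.floor_le (t / ‖h (φ n)‖)) (hpos (φ n)).le
        rwa [div_mul_cancel₀ _ (hpos (φ n)).ne'] at h2
    refine hH.mem_of_tendsto (h1.smul hφu) (Eventually.of_forall fun n => ?_)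
    simp only [Function.comp_apply]
    rw [smul_smul, mul_assoc, mul_inv_cancel₀ (hpos (φ n)).ne', mul_one, Int.cast_smul_eq_zsmul]
    exact H.zsmul_mem (hhH _) _
  have h0 : u = 0 := by
    simpa using (V.mem_orthogonal u).1 huW u huV
  simp [h0] at hu

end

section Stabilizer

variable {E Ω Y : Type*} [NormedAddCommGroup E] [NormedSpace ℝ E] [FiniteDimensional ℝ E]
  [MeasurableSpace E] [BorelSpace E] [MeasurableSpace Ω] {θ : E → Ω → Ω} {P : Measure Ω}
  [MetricSpace Y] [SecondCountableTopology Y] [MeasurableSpace Y] [BorelSpace Y] {G : Ω → Y}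

/-- Measurable maps do not separate points that lie in the same measurable sets. -/
lemma apply_eq_of_forall_measurableSet {Z : Type*} [MeasurableSpace Z] [MeasurableSingletonClass Z]
    {f : Ω → Z} (hf : Measurable f) {ω ω' : Ω} (h : ∀ A, MeasurableSet A → ω ∈ A → ω' ∈ A) :
    f ω' = f ω :=
  h _ (hf (measurableSet_singleton (f ω))) rfl

lemma IsErgodicFlow.measurableSet_forall_ne (hθ : IsErgodicFlow θ P) (hG : Measurable G)
    (hGc : ∀ ω, Continuous fun v => G (θ v ω)) {K : Set E} (hK : IsCompact K) :
    MeasurableSet {ω | ∀ w ∈ K, G (θ w ω) ≠ G ω} := by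
  obtain ⟨D, hDK, hDc, hKD⟩ := hK.isSeparable.exists_countable_dense_subset
  have heq : {ω | ∀ w ∈ K, G (θ w ω) ≠ G ω} =
      ⋃ n : ℕ, ⋂ w ∈ D, {ω | 1 / ((n : ℝ) + 1) ≤ dist (G (θ w ω)) (G ω)} := by
    ext ω
    simp only [mem_ofPred_eq, mem_iUnion, mem_iInter]
    constructor
    · intro h
      rcases K.eq_empty_or_nonempty with h0 | h0
      · exact ⟨0, fun w hw => by simpa [h0] using hDK hw⟩
      · obtain ⟨w0, hw0, hmin⟩ := hK.exists_isMinOn h0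
          (f := fun w => dist (G (θ w ω)) (G ω)) ((hGc ω).dist continuous_const).continuousOn
        obtain ⟨n, hn⟩ := exists_nat_one_div_lt (dist_pos.2 (h w0 hw0))
        exact ⟨n, fun w hw => hn.le.trans (hmin (hDK hw))⟩
    · rintro ⟨n, hn⟩ w hw
      have hcl : IsClosed {w | 1 / ((n : ℝ) + 1) ≤ dist (G (θ w ω)) (G ω)} :=
        isClosed_le continuous_const ((hGc ω).dist continuous_const)
      have hle : 1 / ((n : ℝ) + 1) ≤ dist (G (θ w ω)) (G ω) :=
        closure_minimal (fun w hw => hn w hw) hcl (hKD hw)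
      exact dist_pos.1 (lt_of_lt_of_le (by positivity) hle)
  rw [heq]
  exact MeasurableSet.iUnion fun n => MeasurableSet.biInter hDc fun w _ =>
    measurableSet_le measurable_const ((hG.comp (hθ.measurable_right w)).dist hG)

/-- Stabilizers are constant along orbits. -/
lemma IsErgodicFlow.apply_shift_eq (hθ : IsErgodicFlow θ P) (hG : Measurable G)
    (hGA : ∀ ω ω', G ω = G ω' → ∀ A, MeasurableSet A → ω ∈ A → ω' ∈ A) {v : E} {ω : Ω}
    (h : G (θ v ω) = G ω) (u : E) : G (θ v (θ u ω)) = G (θ u ω) := by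
  rw [hθ.add, add_comm, ← hθ.add]
  exact apply_eq_of_forall_measurableSet (hG.comp (hθ.measurable_right u)) (hGA _ _ h.symm)

/-- The stabilizer of almost every point is the same closed subgroup. -/
lemma IsErgodicFlow.exists_stabilizer [IsProbabilityMeasure P] (hθ : IsErgodicFlow θ P)
    (hG : Measurable G) (hGc : ∀ ω, Continuous fun v => G (θ v ω))
    (hGA : ∀ ω ω', G ω = G ω' → ∀ A, MeasurableSet A → ω ∈ A → ω' ∈ A) :
    ∃ H : AddSubgroup E, IsClosed (H : Set E) ∧ ∀ᵐ ω ∂P, ∀ v, v ∈ H ↔ G (θ v ω) = G ω := by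
  have : ProperSpace E := FiniteDimensional.proper ℝ E
  have hshift : ∀ {v ω}, G (θ v ω) = G ω → ∀ u, G (θ v (θ u ω)) = G (θ u ω) := fun h u =>
    hθ.apply_shift_eq hG hGA h u
  set K : ℕ × ℕ → Set E := fun q =>
    Metric.closedBall (TopologicalSpace.denseSeq E q.1) (1 / ((q.2 : ℝ) + 1)) with hK
  have hae : ∀ᵐ ω ∂P, ∀ q, (∀ w ∈ K q, G (θ w ω) ≠ G ω) ↔
      ∀ᵐ ω' ∂P, ∀ w ∈ K q, G (θ w ω') ≠ G ω' := by
    refine ae_all_iff.2 fun q => ?_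
    rcases hθ.ae_or_ae_not (hθ.measurableSet_forall_ne hG hGc (isCompact_closedBall
      (TopologicalSpace.denseSeq E q.1) (1 / ((q.2 : ℝ) + 1)))) (fun x ω h w hw hc => h w hw (by
        have := hshift hc (-x)
        rwa [hθ.neg_apply] at this)) with h | h
    · exact h.mono fun ω hω => iff_of_true hω h
    · refine h.mono fun ω hω => iff_of_false hω fun hc => ?_
      obtain ⟨ω', h1, h2⟩ := (h.and hc).exists
      exact h1 h2
  obtain ⟨ω0, h0⟩ := hae.exists
  have hsep : ∀ {ω v}, G (θ v ω) ≠ G ω → ∃ q, v ∈ K q ∧ ∀ w ∈ K q, G (θ w ω) ≠ G ω := by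
    intro ω v hv
    have hop : IsOpen {w | G (θ w ω) ≠ G ω} := isOpen_ne_fun (hGc ω) continuous_const
    obtain ⟨r, hr, hball⟩ := Metric.isOpen_iff.1 hop v hv
    obtain ⟨n, hn⟩ := exists_nat_one_div_lt (half_pos hr)
    obtain ⟨i, hi⟩ := (TopologicalSpace.denseRange_denseSeq E).exists_dist_lt v
      (show (0 : ℝ) < 1 / ((n : ℝ) + 1) by positivity)
    refine ⟨(i, n), Metric.mem_closedBall.2 hi.le, fun w hw => hball ?_⟩
    have := dist_triangle_right w v (TopologicalSpace.denseSeq E i)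
    have hw' : dist w (TopologicalSpace.denseSeq E i) ≤ 1 / ((n : ℝ) + 1) := hw
    exact Metric.mem_ball.2 (by linarith)
  refine ⟨{ carrier := {v | G (θ v ω0) = G ω0}, zero_mem' := by simp [hθ.zero],
            add_mem' := ?_, neg_mem' := ?_ }, isClosed_eq (hGc ω0) continuous_const, ?_⟩
  · intro a b ha hb
    have ha' : G (θ a ω0) = G ω0 := ha
    have hb' : G (θ b ω0) = G ω0 := hb
    show G (θ (a + b) ω0) = G ω0
    rw [← hθ.add, hshift hb', ha']
  · intro a ha
    have := hshift (show G (θ a ω0) = G ω0 from ha) (-a)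
    show G (θ (-a) ω0) = G ω0
    rw [← this, hθ.add, neg_add_cancel, hθ.zero]
  · filter_upwards [hae] with ω h v
    refine ⟨fun hv => ?_, fun hv => ?_⟩
    · by_contra hne
      obtain ⟨q, hq, hq'⟩ := hsep hne
      exact (h0 q).2 ((h q).1 hq') v hq hv
    · by_contra hne
      obtain ⟨q, hq, hq'⟩ := hsep (show G (θ v ω0) ≠ G ω0 from hne)
      exact (h q).2 ((h0 q).1 hq') v hq hv

end Stabilizer

section

variable {F : Type*} [NormedAddCommGroup F] [NormedSpace ℝ F] [FiniteDimensional ℝ F]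
  [MeasurableSpace F] [BorelSpace F]

/-- Version of `ext_of_invariant_fst` with a σ-finiteness assumption. -/
lemma ext_of_invariant_fst_of_cover {W : Type*} [MeasurableSpace W] {m n : Measure (F × W)}
    (hm : ∀ v, m.map (fun p => (v + p.1, p.2)) = m) (hn : ∀ v, n.map (fun p => (v + p.1, p.2)) = n)
    {B : ℕ → Set W} (hB : ∀ N, MeasurableSet (B N)) (hU : ⋃ N, B N = univ)
    (hfin : ∀ N, n (Metric.closedBall 0 1 ×ˢ B N) ≠ ⊤)
    (h : ∀ A, MeasurableSet A → m (Metric.closedBall 0 1 ×ˢ A) = n (Metric.closedBall 0 1 ×ˢ A)) :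
    m = n := by
  have hcov : ⋃ N, (univ : Set F) ×ˢ B N = univ := by
    rw [← prod_iUnion, hU, univ_prod_univ]
  have hinv : ∀ {k : Measure (F × W)}, (∀ v, k.map (fun p => (v + p.1, p.2)) = k) →
      ∀ N v, (k.restrict (univ ×ˢ B N)).map (fun p => (v + p.1, p.2)) =
        k.restrict (univ ×ˢ B N) := by
    intro k hk N v
    have hvm : Measurable fun p : F × W => (v + p.1, p.2) :=
      (measurable_fst.const_add v).prodMk measurable_snd
    have h1 := Measure.restrict_map (μ := k) hvm (MeasurableSet.univ.prod (hB N))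
    rw [hk v] at h1
    refine Eq.trans ?_ h1.symm
    congr 2
  have hres : ∀ (k : Measure (F × W)) N A, k.restrict (univ ×ˢ B N) (Metric.closedBall 0 1 ×ˢ A) =
      k (Metric.closedBall 0 1 ×ˢ (A ∩ B N)) := by
    intro k N A
    rw [Measure.restrict_apply' (MeasurableSet.univ.prod (hB N)), prod_inter_prod, inter_univ]
  refine (Measure.ext_iff_of_iUnion_eq_univ hcov).2 fun N =>
    ext_of_invariant_fst (hinv hm N) (hinv hn N) ?_ fun A hA => ?_
  · rw [hres, univ_inter]
    exact hfin N
  · rw [hres, hres]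
    exact h _ (hA.inter (hB N))

end

section Subsingleton

/-- Over the trivial group, equivariant kernels of the same intensity are almost surely equal. -/
lemma IsErgodicFlow.ae_eq_of_subsingleton {W Ω : Type*} [NormedAddCommGroup W] [NormedSpace ℝ W]
    [Subsingleton W] [MeasurableSpace W] [MeasurableSpace Ω]
    {θ : W → Ω → Ω} {P : Measure Ω} [IsProbabilityMeasure P] (hθ : IsErgodicFlow θ P)
    {μ ν : Kernel Ω W} (hfin : ∫⁻ ω, μ ω univ ∂P < ⊤)
    (hint : ∫⁻ ω, μ ω univ ∂P = ∫⁻ ω, ν ω univ ∂P) : ∀ᵐ ω ∂P, μ ω = ν ω := by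
  have key : ∀ {μ ν : Kernel Ω W}, ∫⁻ ω, μ ω univ ∂P < ⊤ →
      ∫⁻ ω, μ ω univ ∂P = ∫⁻ ω, ν ω univ ∂P → ∀ᵐ ω ∂P, ¬ μ ω univ < ν ω univ := by
    intro μ ν hfin hint
    have hμ : Measurable fun ω => μ ω univ := μ.measurable_coe MeasurableSet.univ
    have hν : Measurable fun ω => ν ω univ := ν.measurable_coe MeasurableSet.univ
    refine (hθ.ae_or_ae_not (p := fun ω => μ ω univ < ν ω univ) (measurableSet_lt hμ hν)
      fun x ω h => ?_).resolve_left fun h => ?_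
    · rwa [Subsingleton.elim x 0, hθ.zero]
    · exact (lintegral_strict_mono (NeZero.ne P) hν.aemeasurable hfin.ne h).ne hint
  filter_upwards [key hfin hint, key (hint ▸ hfin) hint.symm] with ω h1 h2
  have huniv : μ ω univ = ν ω univ := le_antisymm (not_lt.1 h2) (not_lt.1 h1)
  ext B hB
  rcases B.eq_empty_or_nonempty with rfl | h
  · simp
  · rwa [Subsingleton.eq_univ_of_nonempty h]

end Subsingleton

section Transverse

variable {E Ω Y : Type*} [NormedAddCommGroup E] [InnerProductSpace ℝ E] [FiniteDimensional ℝ E]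
  [MeasurableSpace E] [BorelSpace E] [MeasurableSpace Ω] {θ : E → Ω → Ω} {P : Measure Ω}
  [MetricSpace Y] [SecondCountableTopology Y] [MeasurableSpace Y] [BorelSpace Y] {G : Ω → Y}

/-- If `V` fixes almost every point, the restriction of the flow to `Vᗮ` is still ergodic. -/
lemma IsErgodicFlow.restrict_orthogonal [IsProbabilityMeasure P] (hθ : IsErgodicFlow θ P)
    (hG : Measurable G) (hGc : ∀ ω, Continuous fun v => G (θ v ω))
    (hGA : ∀ ω ω', G ω = G ω' → ∀ A, MeasurableSet A → ω ∈ A → ω' ∈ A) {V : Submodule ℝ E}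
    (hV : ∀ᵐ ω ∂P, ∀ v ∈ V, G (θ v ω) = G ω) :
    IsErgodicFlow (fun (w : Vᗮ) ω => θ w ω) P where
  measurable := hθ.measurable.comp
    ((measurable_subtype_coe.comp measurable_fst).prodMk measurable_snd)
  zero := hθ.zero
  add x y ω := hθ.add x y ω
  preserving x := hθ.preserving x
  ergodic A hA hinv := by
    obtain ⟨D, hDV, hDc, hVD⟩ := (TopologicalSpace.IsSeparable.of_separableSpace
      (V : Set E)).exists_countable_dense_subset
    have heq : {ω | ∀ v ∈ V, G (θ v ω) = G ω} = ⋂ v ∈ D, {ω | G (θ v ω) = G ω} := by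
      ext ω
      simp only [mem_ofPred_eq, mem_iInter]
      refine ⟨fun h v hv => h v (hDV hv), fun h v hv => ?_⟩
      have hcl : IsClosed {v | G (θ v ω) = G ω} := isClosed_eq (hGc ω) continuous_const
      exact closure_minimal (fun v hv => h v hv) hcl (hVD hv)
    have hm : MeasurableSet {ω | ∀ v ∈ V, G (θ v ω) = G ω} := by
      rw [heq]
      exact MeasurableSet.biInter hDc fun v _ =>
        measurableSet_eq_fun (hG.comp (hθ.measurable_right v)) hG
    have hmA : MeasurableSet {ω | ω ∈ A ∧ ∀ v ∈ V, G (θ v ω) = G ω} := hA.inter hm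
    have hmA' : ∀ x ω, (ω ∈ A ∧ ∀ v ∈ V, G (θ v ω) = G ω) →
        θ x ω ∈ A ∧ ∀ v ∈ V, G (θ v (θ x ω)) = G (θ x ω) := by
      intro x ω hω
      refine ⟨?_, fun v hv => hθ.apply_shift_eq hG hGA (hω.2 v hv) x⟩
      have hw : θ (Vᗮ.starProjection x) ω ∈ A :=
        (hinv ⟨_, Submodule.starProjection_apply_mem Vᗮ x⟩).symm.subset hω.1
      have hx : θ x ω = θ (V.starProjection x) (θ (Vᗮ.starProjection x) ω) := by
        rw [hθ.add, add_comm, Submodule.starProjection_add_starProjection_orthogonal]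
      rw [hx]
      exact hGA _ _ (hθ.apply_shift_eq hG hGA
        (hω.2 _ (Submodule.starProjection_apply_mem V x)) _).symm A hA hw
    rcases hθ.ae_or_ae_not hmA hmA' with h | h
    · exact Or.inr ((prob_compl_eq_zero_iff hA).1 (h.mono fun ω hω => hω.1))
    · refine Or.inl (measure_eq_zero_iff_ae_notMem.2 ?_)
      filter_upwards [h, hV] with ω h1 h2 h3 using h1 ⟨h3, h2⟩

/-- The kernel on `Vᗮ` obtained by projecting the slab around `Vᗮ`. -/
def transverse (V : Submodule ℝ E) (ξ : Kernel Ω E) : Kernel Ω Vᗮ :=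
  (ξ.restrict (s := {x | V.orthogonalProjectionOnto x ∈ Metric.closedBall 0 1})
    (V.orthogonalProjectionOnto.continuous.measurable measurableSet_closedBall)).map
      Vᗮ.orthogonalProjectionOnto

variable {V : Submodule ℝ E} {ξ η : Kernel Ω E}

lemma transverse_apply (ω : Ω) {B : Set Vᗮ} (hB : MeasurableSet B) :
    transverse V ξ ω B = ξ ω {x | V.orthogonalProjectionOnto x ∈ Metric.closedBall 0 1 ∧
      Vᗮ.orthogonalProjectionOnto x ∈ B} := by
  rw [transverse, Kernel.map_apply' _ Vᗮ.orthogonalProjectionOnto.continuous.measurable _ hB,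
    Kernel.restrict_apply' _ _ _ (Vᗮ.orthogonalProjectionOnto.continuous.measurable hB)]
  congr 1
  ext x
  exact and_comm

lemma isCompact_slab {K : Set Vᗮ} (hK : IsCompact K) :
    IsCompact {x | V.orthogonalProjectionOnto x ∈ Metric.closedBall 0 1 ∧
      Vᗮ.orthogonalProjectionOnto x ∈ K} := by
  have : ProperSpace V := FiniteDimensional.proper ℝ V
  have h := ((isCompact_closedBall (0 : V) 1).prod hK).image
    (show Continuous fun p : V × Vᗮ => (p.1 : E) + p.2 by fun_prop)
  convert h using 1
  ext x
  constructor
  · intro hx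
    refine ⟨(V.orthogonalProjectionOnto x, Vᗮ.orthogonalProjectionOnto x), hx, ?_⟩
    exact Submodule.starProjection_add_starProjection_orthogonal (K := V) x
  · rintro ⟨⟨v, w⟩, hvw, rfl⟩
    have h1 : V.orthogonalProjectionOnto (w : E) = 0 :=
      Submodule.orthogonalProjectionOnto_apply_of_mem_orthogonal w.2
    have h2 : Vᗮ.orthogonalProjectionOnto (v : E) = 0 :=
      Submodule.orthogonalProjectionOnto_orthogonal_apply_eq_zero v.2
    rw [mem_ofPred_eq, map_add, map_add, h1, h2, add_zero, zero_add,
      Submodule.orthogonalProjectionOnto_mem_subspace_eq_self,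
      Submodule.orthogonalProjectionOnto_mem_subspace_eq_self]
    exact hvw

lemma IsEquivariant.transverse_orthogonal (hξ : IsEquivariant θ ξ) :
    IsEquivariant (fun (w : Vᗮ) ω => θ w ω) (transverse V ξ) where
  shift ω w := by
    ext B hB
    have hB' : MeasurableSet {y : Vᗮ | y - w ∈ B} := (measurable_id.sub_const w) hB
    have hS : MeasurableSet {x | V.orthogonalProjectionOnto x ∈ Metric.closedBall 0 1 ∧
        Vᗮ.orthogonalProjectionOnto x ∈ B} :=
      (V.orthogonalProjectionOnto.continuous.measurable measurableSet_closedBall).inter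
        (Vᗮ.orthogonalProjectionOnto.continuous.measurable hB)
    have hw : Measurable fun y : Vᗮ => y - w := measurable_id.sub_const w
    rw [Measure.map_apply hw hB, transverse_apply _ hB, hξ.shift_apply _ _ hS]
    refine Eq.trans ?_ (transverse_apply _ hB').symm
    have h1 : V.orthogonalProjectionOnto (w : E) = 0 :=
      Submodule.orthogonalProjectionOnto_apply_of_mem_orthogonal w.2
    congr 1
    ext y
    simp only [mem_ofPred_eq, map_sub, h1, sub_zero,
      Submodule.orthogonalProjectionOnto_mem_subspace_eq_self]
  lt_top ω K hK := by
    rw [transverse_apply _ hK.measurableSet]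
    exact hξ.lt_top _ _ (isCompact_slab hK)

/-- Balancing displacement for the projections along a subspace that fixes almost every point. -/
lemma exists_transverse_displacement [IsProbabilityMeasure P] (hθ : IsErgodicFlow θ P)
    (hξ : IsEquivariant θ ξ) (hη : IsEquivariant θ η)
    (hfin : ∀ K, IsCompact K → ∫⁻ ω, ξ ω K ∂P < ⊤)
    (hint : ∀ K, IsCompact K → ∫⁻ ω, ξ ω K ∂P = ∫⁻ ω, η ω K ∂P)
    (hξV : V ≠ ⊤ → ∀ᵐ ω ∂P, ∀ x, ξ ω {y | y - x ∈ V} = 0)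
    (hηV : V ≠ ⊤ → ∀ᵐ ω ∂P, ∀ x, η ω {y | y - x ∈ V} = 0)
    (hG : Measurable G) (hGc : ∀ ω, Continuous fun v => G (θ v ω))
    (hGA : ∀ ω ω', G ω = G ω' → ∀ A, MeasurableSet A → ω ∈ A → ω' ∈ A)
    (hV : ∀ᵐ ω ∂P, ∀ v ∈ V, G (θ v ω) = G ω) {ε : ℝ} (hε : 0 < ε)
    (hfree : ∀ᵐ ω ∂P, ∀ w ∈ Vᗮ, 0 < ‖w‖ → ‖w‖ ≤ ε → G (θ w ω) ≠ G ω) :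
    ∃ τ : Ω → Vᗮ, Measurable τ ∧ ∀ᵐ ω ∂P,
      (transverse V ξ ω).map (fun w : Vᗮ => w + τ (θ w ω)) = transverse V η ω := by
  have hW := hθ.restrict_orthogonal hG hGc hGA hV
  have hfin' : ∀ K, IsCompact K → ∫⁻ ω, transverse V ξ ω K ∂P < ⊤ := fun K hK => by
    simpa only [transverse_apply _ hK.measurableSet] using hfin _ (isCompact_slab hK)
  have hint' : ∀ K, IsCompact K →
      ∫⁻ ω, transverse V ξ ω K ∂P = ∫⁻ ω, transverse V η ω K ∂P := fun K hK => by
    simpa only [transverse_apply _ hK.measurableSet] using hint _ (isCompact_slab hK)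
  by_cases hVtop : V = ⊤
  · have : Subsingleton Vᗮ := Submodule.subsingleton_iff_eq_bot.2
      (Submodule.orthogonal_eq_bot_iff.2 hVtop)
    have huniv : IsCompact (univ : Set Vᗮ) := (Set.subsingleton_univ).isCompact
    refine ⟨0, measurable_const, ?_⟩
    filter_upwards [hW.ae_eq_of_subsingleton (hfin' _ huniv) (hint' _ huniv)] with ω hω
    simpa using hω
  · have hdiff : ∀ {ξ : Kernel Ω E}, (∀ᵐ ω ∂P, ∀ x, ξ ω {y | y - x ∈ V} = 0) →
        ∀ᵐ ω ∂P, ∀ w, transverse V ξ ω {w} = 0 := by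
      intro ξ h
      filter_upwards [h] with ω hω w
      rw [transverse_apply _ (measurableSet_singleton w)]
      have hsub : {x | V.orthogonalProjectionOnto x ∈ Metric.closedBall 0 1 ∧
          Vᗮ.orthogonalProjectionOnto x ∈ ({w} : Set Vᗮ)} ⊆ {y | y - (w : E) ∈ V} := by
        rintro x ⟨-, rfl⟩
        have : x - Vᗮ.starProjection x = V.starProjection x :=
          sub_eq_of_eq_add (Submodule.starProjection_add_starProjection_orthogonal x).symm
        show x - Vᗮ.starProjection x ∈ V
        rw [this]
        exact Submodule.starProjection_apply_mem V x
      exact measure_mono_null hsub (hω _)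
    exact exists_displacement_of_free hW hξ.transverse_orthogonal hη.transverse_orthogonal hfin'
      hint'
      (hdiff (hξV hVtop)) (hdiff (hηV hVtop)) hG
      (fun ω => (hGc ω).comp continuous_subtype_val) hε
      (hfree.mono fun ω hω w => hω w w.2)

/-- **Balancing displacement** for kernels that do not charge translates of proper subspaces, when
the measurable structure is generated by a map that is continuous along the flow. -/
theorem exists_displacement [IsProbabilityMeasure P] (hθ : IsErgodicFlow θ P)
    (hξ : IsEquivariant θ ξ) (hη : IsEquivariant θ η)
    (hfin : ∀ K, IsCompact K → ∫⁻ ω, ξ ω K ∂P < ⊤)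
    (hint : ∀ K, IsCompact K → ∫⁻ ω, ξ ω K ∂P = ∫⁻ ω, η ω K ∂P)
    (hξV : ∀ V : Submodule ℝ E, V ≠ ⊤ → ∀ᵐ ω ∂P, ∀ x, ξ ω {y | y - x ∈ V} = 0)
    (hηV : ∀ V : Submodule ℝ E, V ≠ ⊤ → ∀ᵐ ω ∂P, ∀ x, η ω {y | y - x ∈ V} = 0)
    (hG : Measurable G) (hGc : ∀ ω, Continuous fun v => G (θ v ω))
    (hGA : ∀ ω ω', G ω = G ω' → ∀ A, MeasurableSet A → ω ∈ A → ω' ∈ A) :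
    ∃ τ : Ω → E, Measurable τ ∧ ∀ᵐ ω ∂P, (ξ ω).map (fun x => x + τ (θ x ω)) = η ω := by
  obtain ⟨H, hHc, hH⟩ := hθ.exists_stabilizer hG hGc hGA
  obtain ⟨V, hVH, ε, hε, hVε⟩ := exists_submodule_of_isClosed H hHc
  have hV : ∀ᵐ ω ∂P, ∀ v ∈ V, G (θ v ω) = G ω := hH.mono fun ω h v hv => (h v).1 (hVH v hv)
  obtain ⟨τ, hτ, hbal⟩ := exists_transverse_displacement hθ hξ hη hfin hint (hξV V) (hηV V) hG hGc
    hGA hV hε (hH.mono fun ω h w hw h0 h1 heq =>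
      h0.ne' (norm_eq_zero.2 (hVε w ((h w).2 heq) hw h1)))
  refine ⟨fun ω => τ ω, measurable_subtype_coe.comp hτ, ?_⟩
  filter_upwards [hV, hbal] with ω hω hbal
  set p := V.orthogonalProjectionOnto with hp
  set q := Vᗮ.orthogonalProjectionOnto with hq
  have hpm : Measurable p := p.continuous.measurable
  have hqm : Measurable q := q.continuous.measurable
  have hpv : ∀ v : V, p v = v := Submodule.orthogonalProjectionOnto_mem_subspace_eq_self
  have hqv : ∀ v : V, q v = 0 := fun v =>
    Submodule.orthogonalProjectionOnto_orthogonal_apply_eq_zero v.2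
  have hpq : ∀ x, (p x : E) + q x = x := Submodule.starProjection_add_starProjection_orthogonal
  have hτm : Measurable fun x => τ (θ x ω) := hτ.comp (hθ.measurable_left ω)
  have hτv : ∀ (v : V) x, τ (θ (v + x) ω) = τ (θ x ω) := by
    intro v x
    rw [add_comm, ← hθ.add]
    exact apply_eq_of_forall_measurableSet hτ
      (hGA _ _ (hθ.apply_shift_eq hG hGA (hω v v.2) x).symm)
  have hinv : ∀ {ζ : Kernel Ω E}, IsEquivariant θ ζ → ∀ v : V,
      (ζ ω).map (fun x => (v : E) + x) = ζ ω := by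
    intro ζ hζ v
    have h1 : ζ (θ (-v : V) ω) = (ζ ω).map (fun x => (v : E) + x) := by
      rw [hζ.shift]
      congr 1
      ext x
      rw [Submodule.coe_neg, sub_neg_eq_add, add_comm]
    rw [← h1]
    ext B hB
    exact apply_eq_of_forall_measurableSet (ζ.measurable_coe hB)
      (hGA _ _ (hω _ (-v : V).2).symm)
  have hfm : Measurable fun x => (p x, q x + τ (θ x ω)) := hpm.prodMk (hqm.add hτm)
  have hgm : Measurable fun x => (p x, q x) := hpm.prodMk hqm
  have hVm : ∀ v : V, Measurable fun p : V × Vᗮ => (v + p.1, p.2) := fun v =>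
    (measurable_fst.const_add v).prodMk measurable_snd
  have hVE : ∀ v : V, Measurable fun x : E => (v : E) + x := fun v => measurable_const_add _
  have hball : MeasurableSet (Metric.closedBall (0 : V) 1) := measurableSet_closedBall
  have hn : ∀ A, MeasurableSet A → (η ω).map (fun x => (p x, q x)) (Metric.closedBall 0 1 ×ˢ A) =
      transverse V η ω A := fun A hA => by
    rw [Measure.map_apply hgm (hball.prod hA), transverse_apply _ hA]
    rfl
  have : ProperSpace Vᗮ := FiniteDimensional.proper ℝ _
  have hmn : (ξ ω).map (fun x => (p x, q x + τ (θ x ω))) = (η ω).map (fun x => (p x, q x)) := by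
    refine ext_of_invariant_fst_of_cover (fun v => ?_) (fun v => ?_)
      (B := fun N : ℕ => Metric.closedBall 0 N) (fun N => measurableSet_closedBall)
      (Metric.iUnion_closedBall_nat 0) (fun N => ?_) fun A hA => ?_
    · conv_rhs => rw [← hinv hξ v]
      rw [Measure.map_map (hVm v) hfm, Measure.map_map hfm (hVE v)]
      congr 1
      ext x : 1
      simp only [Function.comp_apply, map_add, hpv, hqv, hτv, zero_add]
    · conv_rhs => rw [← hinv hη v]
      rw [Measure.map_map (hVm v) hgm, Measure.map_map hgm (hVE v)]
      congr 1
      ext x : 1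
      simp only [Function.comp_apply, map_add, hpv, hqv, zero_add]
    · rw [hn _ measurableSet_closedBall]
      exact (hη.transverse_orthogonal.lt_top ω _ (isCompact_closedBall 0 _)).ne
    · have hwm : Measurable fun w : Vᗮ => w + τ (θ w ω) :=
        measurable_id.add (hτm.comp measurable_subtype_coe)
      rw [hn A hA, ← hbal, Measure.map_apply hwm hA, transverse_apply _ (hwm hA),
        Measure.map_apply hfm (hball.prod hA)]
      congr 1
      ext x
      have hx : τ (θ (q x) ω) = τ (θ x ω) := by
        rw [← hτv (p x), hpq]
      simp only [mem_preimage, mem_prod, mem_ofPred_eq, ← hq, ← hp, hx]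
  have hadd : Measurable fun p : V × Vᗮ => (p.1 : E) + p.2 := by fun_prop
  have := congrArg (Measure.map fun p : V × Vᗮ => (p.1 : E) + p.2) hmn
  rw [Measure.map_map hadd hfm, Measure.map_map hadd hgm] at this
  convert this using 1
  · congr 1
    ext x
    simp only [Function.comp_apply, Submodule.coe_add, ← add_assoc, hpq]
  · have hid : (fun p : V × Vᗮ => (p.1 : E) + p.2) ∘ (fun x => (p x, q x)) = id := funext hpq
    rw [hid, Measure.map_id]

end Transverse

section Profile

variable {E Ω : Type*} [NormedAddCommGroup E] [InnerProductSpace ℝ E] [FiniteDimensional ℝ E]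
  [MeasurableSpace E] [BorelSpace E] [MeasurableSpace Ω] {θ : E → Ω → Ω} {P : Measure Ω}

/-- A countable family of bounded open sets. -/
def testSet {E : Type*} [NormedAddCommGroup E] [SecondCountableTopology E]
    (q : Finset (TopologicalSpace.countableBasis E) × ℕ) : Set E :=
  (⋂ B ∈ q.1, (B : Set E)) ∩ Metric.ball 0 q.2

/-- A countable family of continuous functions of bounded support. -/
def testFun {E : Type*} [NormedAddCommGroup E] [SecondCountableTopology E]
    (q : (Finset (TopologicalSpace.countableBasis E) × ℕ) × ℕ) (x : E) : ℝ≥0∞ :=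
  min 1 (q.2 * Metric.infEDist x (testSet q.1)ᶜ)

lemma isOpen_testSet (q : Finset (TopologicalSpace.countableBasis E) × ℕ) :
    IsOpen (testSet q) :=
  (isOpen_biInter_finset fun B _ => TopologicalSpace.isOpen_of_mem_countableBasis B.2).inter
    Metric.isOpen_ball

lemma continuous_testFun (q : (Finset (TopologicalSpace.countableBasis E) × ℕ) × ℕ) :
    Continuous (testFun q) :=
  continuous_const.min ((ENNReal.continuous_const_mul (ENNReal.natCast_ne_top _)).comp
    Metric.continuous_infEDist)

lemma testFun_le (q : (Finset (TopologicalSpace.countableBasis E) × ℕ) × ℕ) (x : E) :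
    testFun q x ≤ (Metric.ball (0 : E) q.1.2).indicator 1 x := by
  by_cases hx : x ∈ Metric.ball (0 : E) q.1.2
  · rw [indicator_of_mem hx]
    exact min_le_left _ _
  · have : x ∈ (testSet q.1)ᶜ := fun h => hx h.2
    rw [testFun, Metric.infEDist_zero_of_mem this]
    simp

lemma iSup_testFun (q : Finset (TopologicalSpace.countableBasis E) × ℕ) (x : E) :
    ⨆ n, testFun (q, n) x = (testSet q).indicator 1 x := by
  by_cases hx : x ∈ testSet q
  · rw [indicator_of_mem hx]
    refine le_antisymm (iSup_le fun n => min_le_left _ _) ?_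
    have h0 : Metric.infEDist x (testSet q)ᶜ ≠ 0 := fun h =>
      (Metric.mem_iff_infEDist_zero_of_closed (isOpen_testSet q).isClosed_compl).2 h hx
    obtain ⟨n, hn⟩ := ENNReal.exists_nat_mul_gt h0 ENNReal.one_ne_top
    exact (le_min le_rfl hn.le).trans (le_iSup (fun n => testFun (q, n) x) n)
  · rw [indicator_of_notMem hx]
    refine le_antisymm (iSup_le fun n => ?_) zero_le
    rw [testFun, Metric.infEDist_zero_of_mem (show x ∈ (testSet q)ᶜ from hx)]
    simp

/-- The integrals of the test functions determine a locally finite measure. -/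
lemma ext_of_lintegral_testFun {m n : Measure E} (hn : ∀ K, IsCompact K → n K < ⊤)
    (h : ∀ q, ∫⁻ x, testFun q x ∂m = ∫⁻ x, testFun q x ∂n) : m = n := by
  have : ProperSpace E := FiniteDimensional.proper ℝ E
  have hset : ∀ q, m (testSet q) = n (testSet q) := by
    intro q
    have key : ∀ k : Measure E, k (testSet q) = ⨆ i, ∫⁻ x, testFun (q, i) x ∂k := by
      intro k
      rw [← lintegral_indicator_one (isOpen_testSet q).measurableSet,
        ← lintegral_iSup (fun i => (continuous_testFun _).measurable)]
      · exact lintegral_congr fun x => (iSup_testFun q x).symm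
      · intro i j hij x
        refine min_le_min_left _ ?_
        gcongr
    rw [key, key]
    simp only [h]
  refine Measure.ext_of_generateFrom_of_iUnion (range (testSet (E := E)))
    (fun n => testSet (∅, n)) ?_ ?_ ?_ (fun i => mem_range_self _) (fun i => ?_) ?_
  · refine le_antisymm ?_ (MeasurableSpace.generateFrom_le ?_)
    · rw [BorelSpace.measurable_eq (α := E),
        (TopologicalSpace.isBasis_countableBasis E).borel_eq_generateFrom]
      refine MeasurableSpace.generateFrom_le fun B hB => ?_
      have : B = ⋃ n : ℕ, testSet ({⟨B, hB⟩}, n) := by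
        simp only [testSet, Finset.mem_singleton, iInter_iInter_eq_left, ← inter_iUnion,
          Metric.iUnion_ball_nat, inter_univ]
      rw [this]
      exact MeasurableSet.iUnion fun n => MeasurableSpace.measurableSet_generateFrom
        (mem_range_self _)
    · rintro _ ⟨q, rfl⟩
      exact (isOpen_testSet q).measurableSet
  · rintro _ ⟨q, rfl⟩ _ ⟨r, rfl⟩ -
    classical
    refine ⟨(q.1 ∪ r.1, min q.2 r.2), ?_⟩
    ext x
    simp only [testSet, mem_inter_iff, mem_iInter, Finset.mem_union, mem_ball_zero_iff,
      Nat.cast_min, lt_min_iff]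
    constructor
    · exact fun h => ⟨⟨fun B hB => h.1 B (Or.inl hB), h.2.1⟩, fun B hB => h.1 B (Or.inr hB), h.2.2⟩
    · exact fun h => ⟨fun B hB => hB.elim (h.1.1 B) (h.2.1 B), h.1.2, h.2.2⟩
  · simp [testSet, Metric.iUnion_ball_nat]
  · rw [hset]
    exact ((measure_mono (inter_subset_right.trans Metric.ball_subset_closedBall)).trans_lt
      (hn _ (isCompact_closedBall 0 _))).ne
  · rintro _ ⟨q, rfl⟩
    exact hset q

/-- The integrals of the test functions along an orbit depend continuously on the shift. -/
lemma IsEquivariant.continuous_lintegral_testFun {ξ : Kernel Ω E} (hξ : IsEquivariant θ ξ) (ω : Ω)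
    (q : (Finset (TopologicalSpace.countableBasis E) × ℕ) × ℕ) :
    Continuous fun v => ∫⁻ x, testFun q x ∂ξ (θ v ω) := by
  have : ProperSpace E := FiniteDimensional.proper ℝ E
  have heq : ∀ v, ∫⁻ x, testFun q x ∂ξ (θ v ω) = ∫⁻ x, testFun q (x - v) ∂ξ ω := fun v => by
    have hv : Measurable fun y : E => y - v := measurable_id.sub_const v
    rw [hξ.shift, lintegral_map (continuous_testFun q).measurable hv]
  simp only [heq]
  refine continuous_iff_continuousAt.2 fun v => ?_
  set R : ℝ := ‖v‖ + 1 + q.1.2 with hR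
  refine tendsto_lintegral_filter_of_dominated_convergence
    ((Metric.closedBall (0 : E) R).indicator 1)
    (Eventually.of_forall fun w => (continuous_testFun q).measurable.comp
      (measurable_id.sub_const w)) ?_ ?_ ?_
  · filter_upwards [Metric.ball_mem_nhds v one_pos] with w hw
    refine Eventually.of_forall fun x => (testFun_le q _).trans ?_
    by_cases hx : x ∈ Metric.closedBall (0 : E) R
    · rw [indicator_of_mem hx]
      exact indicator_le_self' (fun _ _ => zero_le) (x - w)
    · have hxw : x - w ∉ Metric.ball (0 : E) q.1.2 := by
        intro h
        rw [mem_ball_zero_iff] at h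
        rw [mem_ball_iff_norm] at hw
        rw [mem_closedBall_zero_iff] at hx
        have h1 := norm_add_le (x - w) w
        have h2 := norm_add_le (w - v) v
        rw [sub_add_cancel] at h1 h2
        linarith
      rw [indicator_of_notMem hxw]
      exact zero_le
  · rw [lintegral_indicator_one measurableSet_closedBall]
    exact (hξ.lt_top ω _ (isCompact_closedBall 0 _)).ne
  · exact Eventually.of_forall fun x =>
      ((continuous_testFun q).comp (continuous_const.sub continuous_id)).tendsto v

/-- **Balancing displacement** when the measurable structure is generated by the two kernels. -/
theorem exists_displacement_of_generated [IsProbabilityMeasure P] (hθ : IsErgodicFlow θ P)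
    {ξ η : Kernel Ω E} (hξ : IsEquivariant θ ξ) (hη : IsEquivariant θ η)
    (hfin : ∀ K, IsCompact K → ∫⁻ ω, ξ ω K ∂P < ⊤)
    (hint : ∀ K, IsCompact K → ∫⁻ ω, ξ ω K ∂P = ∫⁻ ω, η ω K ∂P)
    (hξV : ∀ V : Submodule ℝ E, V ≠ ⊤ → ∀ᵐ ω ∂P, ∀ x, ξ ω {y | y - x ∈ V} = 0)
    (hηV : ∀ V : Submodule ℝ E, V ≠ ⊤ → ∀ᵐ ω ∂P, ∀ x, η ω {y | y - x ∈ V} = 0)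
    (hgen : ∀ ω ω', ξ ω = ξ ω' → η ω = η ω' → ∀ A, MeasurableSet A → ω ∈ A → ω' ∈ A) :
    ∃ τ : Ω → E, Measurable τ ∧ ∀ᵐ ω ∂P, (ξ ω).map (fun x => x + τ (θ x ω)) = η ω := by
  let I := (Finset (TopologicalSpace.countableBasis E) × ℕ) × ℕ
  let _ : MetricSpace (I → ℝ≥0∞ × ℝ≥0∞) := TopologicalSpace.metrizableSpaceMetric _
  have : Countable I := inferInstance
  have hm : ∀ (ζ : Kernel Ω E) (q : I), Measurable fun ω => ∫⁻ x, testFun q x ∂ζ ω := fun ζ q =>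
    (continuous_testFun q).measurable.lintegral_kernel
  refine exists_displacement hθ hξ hη hfin hint hξV hηV
    (G := fun ω (q : I) => (∫⁻ x, testFun q x ∂ξ ω, ∫⁻ x, testFun q x ∂η ω))
    (measurable_pi_lambda _ fun q => (hm ξ q).prodMk (hm η q))
    (fun ω => continuous_pi fun q => (hξ.continuous_lintegral_testFun ω q).prodMk
      (hη.continuous_lintegral_testFun ω q)) fun ω ω' h => hgen ω ω' ?_ ?_
  · exact ext_of_lintegral_testFun (hξ.lt_top ω') fun q => congrArg Prod.fst (congrFun h q)
  · exact ext_of_lintegral_testFun (hη.lt_top ω') fun q => congrArg Prod.snd (congrFun h q)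

end Profile

section Factor

variable {E Ω : Type*} [NormedAddCommGroup E] [InnerProductSpace ℝ E] [FiniteDimensional ℝ E]
  [MeasurableSpace E] [BorelSpace E]

lemma IsErgodicFlow.trim {m m0 : MeasurableSpace Ω} {θ : E → Ω → Ω} {P : Measure Ω} (hm : m ≤ m0)
    (hθ : IsErgodicFlow θ P)
    (hmeas : Measurable[MeasurableSpace.prod inferInstance m, m] fun p : E × Ω => θ p.1 p.2) :
    @IsErgodicFlow E Ω _ _ m θ (P.trim hm) := by
  have hmx : ∀ x, Measurable[m, m] (θ x) := fun x =>
    hmeas.comp ((@measurable_const _ _ _ m x).prodMk (@measurable_id _ m))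
  refine @IsErgodicFlow.mk E Ω _ _ m θ _ hmeas hθ.zero hθ.add (fun x => ?_) fun A hA h => ?_
  · refine @MeasurePreserving.mk Ω Ω m m _ _ _ (hmx x) ?_
    refine @Measure.ext Ω m _ _ fun A hA => ?_
    rw [@Measure.map_apply Ω Ω m m _ _ (hmx x) A hA, trim_measurableSet_eq hm (hmx x hA),
      trim_measurableSet_eq hm hA]
    exact (hθ.preserving x).measure_preimage (hm _ hA).nullMeasurableSet
  · rw [trim_measurableSet_eq hm hA]
    exact hθ.ergodic A (hm _ hA) h

lemma ae_trim_of_ae {m m0 : MeasurableSpace Ω} {P : Measure Ω} (hm : m ≤ m0) {p : Ω → Prop}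
    (hp : MeasurableSet[m] {ω | p ω}) (h : ∀ᵐ ω ∂P, p ω) : ∀ᵐ ω ∂(P.trim hm), p ω := by
  rw [ae_iff] at h ⊢
  exact (trim_measurableSet_eq hm hp.compl).trans h

lemma measurableSet_forall_translate_eq_zero [MeasurableSpace Ω] (ξ : Kernel Ω E)
    [IsSFiniteKernel ξ] (V : Submodule ℝ E) :
    MeasurableSet {ω | ∀ x, ξ ω {y | y - x ∈ V} = 0} := by
  have hVm : MeasurableSet (V : Set E) := V.closed_of_finiteDimensional.measurableSet
  have ht : MeasurableSet {p : (Ω × E) × E | p.2 - p.1.2 ∈ V} :=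
    (measurable_snd.sub (measurable_snd.comp measurable_fst)) hVm
  have hsec : Measurable fun p : Ω × E => ξ p.1 {y | y - p.2 ∈ V} := measurable_kernel_section ξ ht
  have hint : Measurable fun ω => ∫⁻ x, ξ ω {y | y - x ∈ V} ∂ξ ω :=
    Measurable.lintegral_kernel_prod_right' (κ := ξ) hsec
  have heq : {ω | ∀ x, ξ ω {y | y - x ∈ V} = 0} =
      {ω | ∫⁻ x, ξ ω {y | y - x ∈ V} ∂ξ ω = 0} := by
    ext ω
    simp only [mem_ofPred_eq]
    refine ⟨fun h => by simp [h], fun h x => ?_⟩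
    have hx : Measurable fun x => ξ ω {y | y - x ∈ V} := hsec.comp measurable_prodMk_left
    rw [lintegral_eq_zero_iff hx] at h
    by_contra hne
    have hsub : {x' | x' - x ∈ V} ⊆ {x' | ¬ ξ ω {y | y - x' ∈ V} = 0} := by
      intro x' hx'
      have : {y | y - x' ∈ V} = {y | y - x ∈ V} := by
        ext y
        have hy : y - x = (y - x') + (x' - x) := by abel
        simp only [mem_ofPred_eq]
        rw [hy]
        exact (V.add_mem_iff_left hx').symm
      show ¬ ξ ω {y | y - x' ∈ V} = 0
      rwa [this]
    exact hne (measure_mono_null hsub h)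
  rw [heq]
  exact hint (measurableSet_singleton 0)

/-- Equivariant kernels make the flow measurable for the σ-algebra that they generate. -/
lemma IsEquivariant.measurable_shift {m : MeasurableSpace Ω} {θ : E → Ω → Ω} {ξ : Kernel Ω E}
    (hξ : IsEquivariant θ ξ) : Measurable fun p : E × Ω => ξ (θ p.1 p.2) := by
  have := hξ.isSFiniteKernel
  refine Measure.measurable_of_measurable_coe _ fun B hB => ?_
  have ht : MeasurableSet {p : (Ω × E) × E | p.2 - p.1.2 ∈ B} :=
    (measurable_snd.sub (measurable_snd.comp measurable_fst)) hB
  have hsec : Measurable fun p : Ω × E => ξ p.1 {y | y - p.2 ∈ B} := measurable_kernel_section ξ ht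
  have heq : (fun p : E × Ω => ξ (θ p.1 p.2) B) = fun p : E × Ω => ξ p.2 {y | y - p.1 ∈ B} :=
    funext fun p => hξ.shift_apply p.2 p.1 hB
  rw [heq]
  exact hsec.comp measurable_swap

/-- **Factor allocation** balancing two kernels that do not charge translates of proper
subspaces. -/
theorem exists_factor_allocation {m0 : MeasurableSpace Ω} {θ : E → Ω → Ω} {P : Measure Ω}
    [IsProbabilityMeasure P] (hθ : IsErgodicFlow θ P)
    {ξ η : Kernel Ω E} (hξ : IsEquivariant θ ξ) (hη : IsEquivariant θ η)
    (hfin : ∀ K, IsCompact K → ∫⁻ ω, ξ ω K ∂P < ⊤)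
    (hint : ∀ K, IsCompact K → ∫⁻ ω, ξ ω K ∂P = ∫⁻ ω, η ω K ∂P)
    (hξV : ∀ V : Submodule ℝ E, V ≠ ⊤ → ∀ᵐ ω ∂P, ∀ x, ξ ω {y | y - x ∈ V} = 0)
    (hηV : ∀ V : Submodule ℝ E, V ≠ ⊤ → ∀ᵐ ω ∂P, ∀ x, η ω {y | y - x ∈ V} = 0) :
    ∃ T : Ω → E → E,
      Measurable[(MeasurableSpace.comap (fun ω => (ξ ω, η ω)) inferInstance).prod inferInstance]
        (Function.uncurry T) ∧
      (∀ ω x y, T (θ x ω) y = T ω (y + x) - x) ∧ ∀ᵐ ω ∂P, (ξ ω).map (T ω) = η ω := by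
  have hadd := hθ.add
  have hξs := hξ.shift
  have hξt := hξ.lt_top
  have hηs := hη.shift
  have hηt := hη.lt_top
  have hle' := (ξ.measurable.prodMk η.measurable).comap_le
  obtain ⟨m, hm⟩ : ∃ m, m = MeasurableSpace.comap (fun ω => (ξ ω, η ω)) inferInstance := ⟨_, rfl⟩
  rw [← hm] at hle' ⊢
  have hle : m ≤ m0 := hle'
  have hpair : Measurable[m] fun ω => (ξ ω, η ω) := by
    rw [hm]
    exact comap_measurable _
  let ξ' : @Kernel Ω E m _ := @Kernel.mk Ω E m _ ξ (measurable_fst.comp hpair)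
  let η' : @Kernel Ω E m _ := @Kernel.mk Ω E m _ η (measurable_snd.comp hpair)
  have hξ' : @IsEquivariant E Ω _ _ _ m θ ξ' := @IsEquivariant.mk E Ω _ _ _ m θ ξ' hξs hξt
  have hη' : @IsEquivariant E Ω _ _ _ m θ η' := @IsEquivariant.mk E Ω _ _ _ m θ η' hηs hηt
  have hflow : Measurable[MeasurableSpace.prod inferInstance m, m]
      fun p : E × Ω => θ p.1 p.2 := by
    have h1 : Measurable[MeasurableSpace.prod inferInstance m]
        fun p : E × Ω => (ξ (θ p.1 p.2), η (θ p.1 p.2)) :=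
      (IsEquivariant.measurable_shift hξ').prodMk (IsEquivariant.measurable_shift hη')
    have h2 : Measurable[MeasurableSpace.prod inferInstance m,
        MeasurableSpace.comap (fun ω => (ξ ω, η ω)) inferInstance]
        fun p : E × Ω => θ p.1 p.2 := measurable_comap_iff.2 h1
    rwa [← hm] at h2
  have hθ' := hθ.trim hle hflow
  have hprob : IsProbabilityMeasure (P.trim hle) := ⟨by
    rw [trim_measurableSet_eq hle (@MeasurableSet.univ Ω m), measure_univ]⟩
  have hlint : ∀ (ζ : @Kernel Ω E m _) K, IsCompact K →
      ∫⁻ ω, ζ ω K ∂(P.trim hle) = ∫⁻ ω, ζ ω K ∂P := fun ζ K hK =>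
    lintegral_trim hle (ζ.measurable_coe hK.measurableSet)
  have := @IsEquivariant.isSFiniteKernel E Ω _ _ _ _ _ m θ ξ' hξ'
  have := @IsEquivariant.isSFiniteKernel E Ω _ _ _ _ _ m θ η' hη'
  obtain ⟨τ, hτ, hbal⟩ := @exists_displacement_of_generated E Ω _ _ _ _ _ m θ (P.trim hle) hprob
    hθ' ξ' η' hξ' hη' (fun K hK => (hlint ξ' K hK).trans_lt (hfin K hK))
    (fun K hK => ((hlint ξ' K hK).trans (hint K hK)).trans (hlint η' K hK).symm)
    (fun V hV => ae_trim_of_ae hle (measurableSet_forall_translate_eq_zero ξ' V) (hξV V hV))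
    (fun V hV => ae_trim_of_ae hle (measurableSet_forall_translate_eq_zero η' V) (hηV V hV))
    (fun ω ω' h1 h2 A hA hω => by
      rw [hm] at hA
      obtain ⟨S, -, rfl⟩ := hA
      have h3 : (ξ ω, η ω) = (ξ ω', η ω') := Prod.ext h1 h2
      have h4 : (ξ ω, η ω) ∈ S := hω
      rw [h3] at h4
      exact h4)
  refine ⟨fun ω x => x + τ (θ x ω), ?_, fun ω x y => ?_, ae_of_ae_trim hle hbal⟩
  · exact measurable_snd.add ((hτ.comp hflow).comp measurable_swap)
  · show y + τ (θ y (θ x ω)) = y + x + τ (θ (y + x) ω) - x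
    rw [hadd, add_comm x y]
    abel

end Factor

section Version

variable {E Ω : Type*} [NormedAddCommGroup E] [NormedSpace ℝ E] [FiniteDimensional ℝ E]
  [MeasurableSpace E] [BorelSpace E] [MeasurableSpace Ω] {θ : E → Ω → Ω} {P : Measure Ω}

/-- Equivariant random measures that are almost surely locally finite agree almost surely with
kernels that are everywhere equivariant and locally finite. -/
lemma exists_kernel_version (hadd : ∀ x y ω, θ y (θ x ω) = θ (x + y) ω) (hzero : ∀ ω, θ 0 ω = ω)
    {ξ η : Ω → Measure E} (hξm : ∀ B, MeasurableSet B → Measurable fun ω => ξ ω B)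
    (hηm : ∀ B, MeasurableSet B → Measurable fun ω => η ω B)
    (hξloc : ∀ᵐ ω ∂P, ∀ K, IsCompact K → ξ ω K < ⊤) (hηloc : ∀ᵐ ω ∂P, ∀ K, IsCompact K → η ω K < ⊤)
    (hξeq : ∀ ω x, ξ (θ x ω) = (ξ ω).map (fun y => y - x))
    (hηeq : ∀ ω x, η (θ x ω) = (η ω).map (fun y => y - x)) :
    ∃ ξ' η' : Kernel Ω E, IsEquivariant θ ξ' ∧ IsEquivariant θ η' ∧ (∀ᵐ ω ∂P, ξ' ω = ξ ω) ∧
      (∀ᵐ ω ∂P, η' ω = η ω) ∧ MeasurableSpace.comap (fun ω => (ξ' ω, η' ω)) inferInstance ≤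
        MeasurableSpace.comap ξ inferInstance ⊔ MeasurableSpace.comap η inferInstance := by
  classical
  have : ProperSpace E := FiniteDimensional.proper ℝ E
  set good : Set Ω := {ω | ∀ n : ℕ, ξ ω (Metric.closedBall 0 n) < ⊤ ∧
    η ω (Metric.closedBall 0 n) < ⊤} with hgood
  have hgm : ∀ {m : MeasurableSpace Ω}, Measurable ξ → Measurable η → MeasurableSet good := by
    intro m hξ hη
    have h1 : ∀ (ζ : Ω → Measure E), Measurable ζ → ∀ n : ℕ,
        MeasurableSet {ω | ζ ω (Metric.closedBall 0 n) < ⊤} := fun ζ hζ n =>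
      measurableSet_lt ((Measure.measurable_coe measurableSet_closedBall).comp hζ) measurable_const
    have h2 : good = ⋂ n : ℕ, ({ω | ξ ω (Metric.closedBall 0 n) < ⊤} ∩
        {ω | η ω (Metric.closedBall 0 n) < ⊤}) := by
      ext ω
      simp [hgood]
    rw [h2]
    exact MeasurableSet.iInter fun n => (h1 ξ hξ n).inter (h1 η hη n)
  have htrunc : ∀ {m : MeasurableSpace Ω} {ζ : Ω → Measure E}, Measurable ξ → Measurable η →
      Measurable ζ → Measurable fun ω => if ω ∈ good then ζ ω else 0 := fun hξ hη hζ =>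
    Measurable.ite (hgm hξ hη) hζ measurable_const
  have hξm' : Measurable ξ := Measure.measurable_of_measurable_coe ξ hξm
  have hηm' : Measurable η := Measure.measurable_of_measurable_coe η hηm
  have hfin : ∀ {ζ : Ω → Measure E}, (∀ ω x, ζ (θ x ω) = (ζ ω).map (fun y => y - x)) → ∀ ω,
      (∀ n : ℕ, ζ ω (Metric.closedBall 0 n) < ⊤) →
      ∀ x (n : ℕ), ζ (θ x ω) (Metric.closedBall 0 n) < ⊤ := by
    intro ζ hζ ω h x n
    have hx : Measurable fun y : E => y - x := measurable_id.sub_const x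
    rw [hζ, Measure.map_apply hx measurableSet_closedBall]
    obtain ⟨N, hN⟩ := exists_nat_ge (n + ‖x‖ : ℝ)
    refine (measure_mono ?_).trans_lt (h N)
    intro y hy
    have hy' : ‖y - x‖ ≤ n := by simpa using hy
    have := norm_add_le (y - x) x
    rw [sub_add_cancel] at this
    rw [mem_closedBall_zero_iff]
    linarith
  have hinv : ∀ x ω, ω ∈ good → θ x ω ∈ good := fun x ω h n =>
    ⟨hfin hξeq ω (fun n => (h n).1) x n, hfin hηeq ω (fun n => (h n).2) x n⟩
  have hiff : ∀ x ω, θ x ω ∈ good ↔ ω ∈ good := fun x ω => ⟨fun h => by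
    have := hinv (-x) _ h
    rwa [hadd, add_neg_cancel, hzero] at this, hinv x ω⟩
  have hshift : ∀ {ζ : Ω → Measure E}, (∀ ω x, ζ (θ x ω) = (ζ ω).map (fun y => y - x)) → ∀ ω x,
      (if θ x ω ∈ good then ζ (θ x ω) else 0) =
        (if ω ∈ good then ζ ω else 0).map (fun y => y - x) := by
    intro ζ hζ ω x
    simp only [hiff]
    split_ifs
    · exact hζ ω x
    · simp
  have hcpt : ∀ {ζ : Ω → Measure E}, (∀ ω ∈ good, ∀ n : ℕ, ζ ω (Metric.closedBall 0 n) < ⊤) →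
      ∀ ω K, IsCompact K → (if ω ∈ good then ζ ω else 0) K < ⊤ := by
    intro ζ hζ ω K hK
    split_ifs with h
    · obtain ⟨r, hr⟩ := hK.isBounded.subset_closedBall 0
      obtain ⟨N, hN⟩ := exists_nat_ge r
      exact (measure_mono (hr.trans (Metric.closedBall_subset_closedBall hN))).trans_lt (hζ ω h N)
    · simp
  have hae : ∀ᵐ ω ∂P, ω ∈ good := by
    filter_upwards [hξloc, hηloc] with ω h1 h2 n
    exact ⟨h1 _ (isCompact_closedBall 0 _), h2 _ (isCompact_closedBall 0 _)⟩
  refine ⟨⟨_, htrunc hξm' hηm' hξm'⟩, ⟨_, htrunc hξm' hηm' hηm'⟩,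
    ⟨hshift hξeq, hcpt fun ω h n => (h n).1⟩, ⟨hshift hηeq, hcpt fun ω h n => (h n).2⟩,
    hae.mono fun ω h => if_pos h, hae.mono fun ω h => if_pos h, ?_⟩
  have h1 : Measurable[MeasurableSpace.comap ξ inferInstance ⊔
      MeasurableSpace.comap η inferInstance] ξ := (comap_measurable ξ).mono le_sup_left le_rfl
  have h2 : Measurable[MeasurableSpace.comap ξ inferInstance ⊔
      MeasurableSpace.comap η inferInstance] η := (comap_measurable η).mono le_sup_right le_rfl
  exact ((htrunc h1 h2 h1).prodMk (htrunc h1 h2 h2)).comap_le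

/-- Equivariant kernels with the same finite intensity on a bounded set with nonempty interior have
the same finite intensity on compact sets. -/
lemma IsEquivariant.lintegral_eq_of_lintegral_eq (hθ : IsErgodicFlow θ P) {ξ η : Kernel Ω E}
    (hξ : IsEquivariant θ ξ) (hη : IsEquivariant θ η) {Q : Set E} (hQm : MeasurableSet Q)
    (hQ : (interior Q).Nonempty) (hQb : Bornology.IsBounded Q) (hfin : ∫⁻ ω, ξ ω Q ∂P < ⊤)
    (hint : ∫⁻ ω, ξ ω Q ∂P = ∫⁻ ω, η ω Q ∂P) {K : Set E} (hK : IsCompact K) :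
    ∫⁻ ω, ξ ω K ∂P < ⊤ ∧ ∫⁻ ω, ξ ω K ∂P = ∫⁻ ω, η ω K ∂P := by
  have happ : ∀ (ζ : Kernel Ω E) {B : Set E}, MeasurableSet B →
      (P.bind ζ) B = ∫⁻ ω, ζ ω B ∂P := fun ζ B hB => Measure.bind_apply hB ζ.aemeasurable
  have hinv : ∀ {ζ : Kernel Ω E}, IsEquivariant θ ζ → (P.bind ζ).IsAddLeftInvariant := by
    intro ζ hζ
    refine ⟨fun v => ?_⟩
    ext B hB
    rw [Measure.map_apply (measurable_const_add v) hB, happ ζ hB]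
    refine (happ ζ ((measurable_const_add v) hB)).trans ?_
    rw [← (hθ.preserving (-v)).lintegral_comp (ζ.measurable_coe hB)]
    refine lintegral_congr fun ω => ?_
    rw [hζ.shift_apply _ _ hB]
    congr 1
    ext y
    simp [add_comm]
  have := hinv hξ
  have := hinv hη
  rw [← happ ξ hQm] at hfin
  rw [← happ ξ hQm, ← happ η hQm] at hint
  have heq := eq_of_isAddLeftInvariant_of_measure_eq _ _ hQ hQb hint (hint ▸ hfin.ne)
  rw [← happ ξ hK.measurableSet, ← happ η hK.measurableSet]
  exact ⟨measure_lt_top_of_isCompact_of_isAddLeftInvariant (interior Q) isOpen_interior hQ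
    ((measure_mono interior_subset).trans_lt hfin).ne hK, by rw [heq]⟩

end Version

section Euclidean

variable {d : ℕ}

lemma measurableSet_unitCube : MeasurableSet (unitCube d) := by
  have : unitCube d = ⋂ i, (fun x : Eucl d => x i) ⁻¹' Ico 0 1 := by
    ext x
    simp [unitCube]
  rw [this]
  exact MeasurableSet.iInter fun i => (by fun_prop : Measurable fun x : Eucl d => x i)
    measurableSet_Ico

lemma interior_unitCube_nonempty : (interior (unitCube d)).Nonempty := by
  have hop : IsOpen (⋂ i, (fun x : Eucl d => x i) ⁻¹' Ioo 0 1) :=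
    isOpen_iInter_of_finite fun i => isOpen_Ioo.preimage (by fun_prop)
  refine ⟨WithLp.toLp 2 fun _ => 1 / 2, mem_interior.2 ⟨_, fun x hx i => ?_, hop, ?_⟩⟩
  · exact Ioo_subset_Ico_self (mem_iInter.1 hx i)
  · refine mem_iInter.2 fun i => ?_
    norm_num

lemma isBounded_unitCube : Bornology.IsBounded (unitCube d) := by
  refine (Metric.isBounded_closedBall (x := (0 : Eucl d)) (r := √d)).subset fun x hx => ?_
  rw [mem_closedBall_zero_iff, EuclideanSpace.norm_eq]
  refine Real.sqrt_le_sqrt ?_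
  refine (Finset.sum_le_card_nsmul _ _ 1 fun i _ => ?_).trans (by simp)
  have := hx i
  rw [Real.norm_eq_abs, sq_abs]
  nlinarith [this.1, this.2]

lemma DoesNotChargeSmallSets.translate_eq_zero {μ : Measure (Eucl d)}
    (h : DoesNotChargeSmallSets d μ) {V : Submodule ℝ (Eucl d)} (hV : V ≠ ⊤) (x : Eucl d) :
    μ {y | y - x ∈ V} = 0 := by
  have hlt := Submodule.finrank_lt hV
  rw [finrank_euclideanSpace_fin] at hlt
  obtain ⟨i, hi⟩ : ∃ i : V →ₗ[ℝ] Eucl (d - 1), Function.Injective i := by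
    refine Module.Free.exists_linearMap_injective_of_linearIndependent_of_lift_rank_le
      (EuclideanSpace.basisFun (Fin (d - 1)) ℝ).toBasis.linearIndependent ?_
    rw [← Module.finrank_eq_rank]
    simp only [Cardinal.lift_natCast, Cardinal.mk_fin, Nat.cast_le]
    omega
  obtain ⟨j, hj⟩ := i.exists_leftInverse_of_injective (LinearMap.ker_eq_bot.2 hi)
  have hji : ∀ v, j (i v) = v := fun v => LinearMap.congr_fun hj v
  have hL : LipschitzWith ‖V.subtypeL ∘L LinearMap.toContinuousLinearMap j‖₊
      fun z => x + (j z : Eucl d) :=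
    LipschitzWith.of_dist_le_mul fun a b => by
      rw [dist_add_left]
      exact (V.subtypeL ∘L LinearMap.toContinuousLinearMap j).lipschitz.dist_le_mul a b
  refine measure_mono_null (fun y hy => ?_) (h _ _ hL)
  exact ⟨i ⟨y - x, hy⟩, by simp [hji]⟩

end Euclidean

end Aux

/-- **Proposition.** If both `ξ` and `η` a.s. do not charge small sets, then there exists
a factor allocation balancing `ξ` and `η`. -/
theorem factor_allocation_of_no_small_sets
    {d : ℕ} (hd : 1 ≤ d)
    (ℙ : Measure Ω) [IsProbabilityMeasure ℙ]
    (θ : Eucl d → Ω → Ω)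
    (hθmeas : Measurable fun p : Eucl d × Ω => θ p.1 p.2)
    (hθ0 : ∀ ω, θ 0 ω = ω)
    (hθadd : ∀ (x y : Eucl d) (ω : Ω), θ y (θ x ω) = θ (x + y) ω)
    (hstat : ∀ x : Eucl d, MeasurePreserving (θ x) ℙ ℙ)
    (herg : ∀ A : Set Ω, MeasurableSet A → (∀ x : Eucl d, θ x ⁻¹' A = A) →
      ℙ A = 0 ∨ ℙ A = 1)
    (ξ η : Ω → Measure (Eucl d))
    (hξm : ∀ B : Set (Eucl d), MeasurableSet B → Measurable fun ω => ξ ω B)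
    (hηm : ∀ B : Set (Eucl d), MeasurableSet B → Measurable fun ω => η ω B)
    (hξloc : ∀ᵐ ω ∂ℙ, ∀ K : Set (Eucl d), IsCompact K → ξ ω K < ⊤)
    (hηloc : ∀ᵐ ω ∂ℙ, ∀ K : Set (Eucl d), IsCompact K → η ω K < ⊤)
    (hξeq : ∀ (ω : Ω) (x : Eucl d), ξ (θ x ω) = Measure.map (fun y => y - x) (ξ ω))
    (hηeq : ∀ (ω : Ω) (x : Eucl d), η (θ x ω) = Measure.map (fun y => y - x) (η ω))
    (hfin : ∫⁻ ω, ξ ω (unitCube d) ∂ℙ < ⊤)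
    (hint : ∫⁻ ω, ξ ω (unitCube d) ∂ℙ = ∫⁻ ω, η ω (unitCube d) ∂ℙ)
    (hξsmall : ∀ᵐ ω ∂ℙ, DoesNotChargeSmallSets d (ξ ω))
    (hηsmall : ∀ᵐ ω ∂ℙ, DoesNotChargeSmallSets d (η ω)) :
    ∃ T : Ω → Eucl d → Eucl d,
      IsFactorAllocation θ ξ η T ∧
      ∀ᵐ ω ∂ℙ, Measure.map (T ω) (ξ ω) = η ω := by
  have hθ : IsErgodicFlow θ ℙ := ⟨hθmeas, hθ0, hθadd, hstat, herg⟩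
  obtain ⟨ξ', η', hξ', hη', hξe, hηe, hle⟩ :=
    exists_kernel_version (P := ℙ) hθadd hθ0 hξm hηm hξloc hηloc hξeq hηeq
  have hξQ : ∫⁻ ω, ξ' ω (unitCube d) ∂ℙ = ∫⁻ ω, ξ ω (unitCube d) ∂ℙ :=
    lintegral_congr_ae (hξe.mono fun ω h => by simp only [h])
  have hηQ : ∫⁻ ω, η' ω (unitCube d) ∂ℙ = ∫⁻ ω, η ω (unitCube d) ∂ℙ :=
    lintegral_congr_ae (hηe.mono fun ω h => by simp only [h])
  have hK := fun (K : Set (Eucl d)) (hK : IsCompact K) =>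
    hξ'.lintegral_eq_of_lintegral_eq hθ hη' measurableSet_unitCube interior_unitCube_nonempty
      isBounded_unitCube (hξQ.trans_lt hfin) ((hξQ.trans hint).trans hηQ.symm) hK
  have hsmall : ∀ {ζ : Ω → Measure (Eucl d)} {ζ' : ProbabilityTheory.Kernel Ω (Eucl d)},
      (∀ᵐ ω ∂ℙ, DoesNotChargeSmallSets d (ζ ω)) → (∀ᵐ ω ∂ℙ, ζ' ω = ζ ω) →
      ∀ V : Submodule ℝ (Eucl d), V ≠ ⊤ → ∀ᵐ ω ∂ℙ, ∀ x, ζ' ω {y | y - x ∈ V} = 0 := by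
    intro ζ ζ' h1 h2 V hV
    filter_upwards [h1, h2] with ω h3 h4 x
    rw [h4]
    exact h3.translate_eq_zero hV x
  obtain ⟨T, hTm, hTeq, hTbal⟩ := exists_factor_allocation hθ hξ' hη' (fun K h => (hK K h).1)
    (fun K h => (hK K h).2) (hsmall hξsmall hξe) (hsmall hηsmall hηe)
  have hTσ : Measurable[(sigmaGen ξ η).prod (inferInstance : MeasurableSpace (Eucl d))]
      (Function.uncurry T) :=
    hTm.mono (sup_le_sup (MeasurableSpace.comap_mono hle) le_rfl) le_rfl
  have hσ : sigmaGen ξ η ≤ (inferInstance : MeasurableSpace Ω) :=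
    sup_le (Measure.measurable_of_measurable_coe ξ hξm).comap_le
      (Measure.measurable_of_measurable_coe η hηm).comap_le
  refine ⟨T, ⟨hTσ.mono (sup_le_sup (MeasurableSpace.comap_mono hσ) le_rfl) le_rfl, hTeq, hTσ⟩, ?_⟩
  filter_upwards [hTbal, hξe, hηe] with ω h h1 h2
  rwa [h1, h2] at h
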